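/- arXiv:1312.5192 — 11 statements merged into one kernel-verified Lean document; each statement's English description precedes it below -/
import Mathlib

section
/- Let (V,w) be a finite undirected weighted graph. Let S : ℝ^V → ℝ be convex, even, positively one-homogeneous and satisfy S(f + α·1) = S(f) for all f ∈ ℝ^V and all α ∈ ℝ, and define the set function Ŝ(A) := S(1_A) for A ⊆ V. Assume Ŝ(A) > 0 for every A with ∅ ≠ A ⊊ V. Then inf over all f ∈ ℝ^V with S(f) ≠ 0 of TV(f)/S(f) equals the minimum over all A with ∅ ≠ A ⊊ V of cut(A,Ā)/Ŝ(A). Moreover, for every f ∈ ℝ^V with S(f) ≠ 0 there exists t ∈ ℝ such that C_t := {i ∈ V : f_i > t} satisfies ∅ ≠ C_t ⊊ V and cut(C_t, C̄_t)/Ŝ(C_t) ≤ TV(f)/S(f). -/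
open Finset Filter

/-- Euclidean inner product on `V → ℝ`. -/
def ip {V : Type*} [Fintype V] (f g : V → ℝ) : ℝ := ∑ i, f i * g i

/-- Euclidean norm on `V → ℝ`. -/
noncomputable def nrm {V : Type*} [Fintype V] (f : V → ℝ) : ℝ :=
  Real.sqrt (∑ i, (f i) ^ 2)

/-- The subdifferential of `A` at `f`:  `a ∈ subdiff A f` iff
`A u ≥ A f + ⟨a, u - f⟩` for all `u`. -/
def subdiff {V : Type*} [Fintype V] (A : (V → ℝ) → ℝ) (f : V → ℝ) : Set (V → ℝ) :=
  {a | ∀ u, A f + ip a (u - f) ≤ A u}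

/-- Positively one-homogeneous. -/
def PosOneHom {V : Type*} (A : (V → ℝ) → ℝ) : Prop :=
  ∀ ν : ℝ, 0 ≤ ν → ∀ f, A (ν • f) = ν * A f

/-- Positively `p`-homogeneous (real exponent, via `rpow`). -/
noncomputable def PosPHom {V : Type*} (p : ℝ) (A : (V → ℝ) → ℝ) : Prop :=
  ∀ ν : ℝ, 0 ≤ ν → ∀ f, A (ν • f) = ν ^ p * A f

/-- The inner objective `Φ_f^c` of RatioDCA-prox, with `F f = (R₁ f - R₂ f)/(S₁ f - S₂ f)`. -/
noncomputable def Phi {V : Type*} [Fintype V] (R1 R2 S1 S2 : (V → ℝ) → ℝ)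
    (f r2 s1 g : V → ℝ) (c : ℝ) (u : V → ℝ) : ℝ :=
  R1 u - ip u r2 + ((R1 f - R2 f) / (S1 f - S2 f)) * (S2 u - ip u s1) - c * ip u g

/-- The cut value of a set `A` in the weighted graph `w`. -/
def cutF {n : ℕ} (w : Fin n → Fin n → ℝ) (A : Finset (Fin n)) : ℝ :=
  ∑ i ∈ A, ∑ j ∈ Aᶜ, w i j

/-- The graph total variation `TV f = (1/2) ∑_{i,j} w_{ij} |f_i - f_j|`. -/
noncomputable def tv {n : ℕ} (w : Fin n → Fin n → ℝ) (f : Fin n → ℝ) : ℝ :=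
  (1 / 2) * ∑ i, ∑ j, w i j * |f i - f j|

/-- The indicator vector of a set `A ⊆ V`. -/
def indic {n : ℕ} (A : Finset (Fin n)) : Fin n → ℝ := fun i => if i ∈ A then 1 else 0

/-- The Lovasz extension of a set function `Ŝ` with `Ŝ ∅ = 0`:
`S f = ∑_{i=1}^n f_i (Ŝ(C_{i-1}) - Ŝ(C_i))` where the values of `f` are sorted increasingly
and `C_i` consists of the elements at sorted positions `> i`. -/
noncomputable def lovasz {n : ℕ} (Shat : Finset (Fin n) → ℝ) (f : Fin n → ℝ) : ℝ :=
  ∑ k : Fin n, f (Tuple.sort f k) *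
    (Shat (Finset.univ.filter fun j => (k : ℕ) ≤ ((Tuple.sort f).symm j : ℕ)) -
     Shat (Finset.univ.filter fun j => (k : ℕ) + 1 ≤ ((Tuple.sort f).symm j : ℕ)))

/-- Total variation of an indicator is the cut. -/
theorem tv_indic_eq_cut {n : ℕ} (w : Fin n → Fin n → ℝ) (hwsym : ∀ i j, w i j = w j i)
    (A : Finset (Fin n)) : tv w (indic A) = cutF w A := by
  have h1 : ∀ i j, w i j * |indic A i - indic A j| =
      (if i ∈ A then (if j ∈ Aᶜ then w i j else 0) else 0) +
      (if j ∈ A then (if i ∈ Aᶜ then w j i else 0) else 0) := by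
    intro i j
    rw [hwsym j i]
    by_cases hi : i ∈ A <;> by_cases hj : j ∈ A <;> simp [indic, hi, hj]
  have h2 : ∑ i, ∑ j, (if i ∈ A then (if j ∈ Aᶜ then w i j else 0) else 0) = cutF w A := by
    unfold cutF
    rw [← Finset.sum_filter_add_sum_filter_not univ (fun i => i ∈ A)]
    rw [Finset.sum_eq_zero (s := univ.filter fun i => ¬ i ∈ A)]
    · rw [add_zero, Finset.filter_univ_mem]
      refine Finset.sum_congr rfl fun i hi => ?_
      simp only [hi, if_true]
      rw [← Finset.sum_filter, Finset.filter_univ_mem]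
    · intro i hi
      have : i ∉ A := by simpa using hi
      simp [this]
  unfold tv
  simp_rw [h1, Finset.sum_add_distrib]
  rw [h2, Finset.sum_comm, h2]
  ring

theorem level_key {n : ℕ} (w : Fin n → Fin n → ℝ) (hwsym : ∀ i j, w i j = w j i)
    (S : (Fin n → ℝ) → ℝ) (hsub : ∀ f g, S (f + g) ≤ S f + S g) (hhom : PosOneHom S)
    (hc : ∀ c : ℝ, S (fun _ => c) = 0) (l : ℝ) (hl : 0 ≤ l) (N : ℕ) :
    ∀ f : Fin n → ℝ, (univ.image f).card = N →
    (∀ t : ℝ, (univ.filter fun i => t < f i).Nonempty →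
      (univ.filter fun i => t < f i) ≠ univ →
      l * S (indic (univ.filter fun i => t < f i)) < cutF w (univ.filter fun i => t < f i)) →
    (∃ c, f = fun _ => c) ∨ l * S f < tv w f := by
  induction N using Nat.strong_induction_on with
  | _ N ih =>
  intro f hN hlev
  by_cases hconst : ∃ c, f = fun _ => c
  · exact Or.inl hconst
  right
  have hne : Nonempty (Fin n) := by
    by_contra h
    rw [not_nonempty_iff] at h
    exact hconst ⟨0, funext fun i => (h.false i).elim⟩
  obtain ⟨a, ha⟩ := Finite.exists_max f
  have hB : (univ.filter fun i => f i < f a).Nonempty := by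
    by_contra h
    rw [Finset.not_nonempty_iff_eq_empty, Finset.filter_eq_empty_iff] at h
    exact hconst ⟨f a, funext fun i => le_antisymm (ha i) (not_lt.1 (h (mem_univ i)))⟩
  obtain ⟨b, hb, hbmax⟩ := Finset.exists_max_image _ f hB
  have hba : f b < f a := by simpa using hb
  have hbm : ∀ i, f i < f a → f i ≤ f b := fun i hi => hbmax i (by simpa using hi)
  have hcase : ∀ i, f i = f a ∨ f i ≤ f b := fun i => by
    rcases (ha i).lt_or_eq with h | h
    · exact Or.inr (hbm i h)
    · exact Or.inl h
  set A := univ.filter fun i => f b < f i with hA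
  set g : Fin n → ℝ := fun i => min (f i) (f b) with hg
  have hd : 0 < f a - f b := sub_pos.2 hba
  have hfg : f = g + (f a - f b) • indic A := by
    funext i
    rcases hcase i with h | h
    · simp [hg, indic, hA, h, hba, hba.le]
    · simp [hg, indic, hA, not_lt.2 h, h]
  have hSf : S f ≤ S g + (f a - f b) * S (indic A) := by
    conv_lhs => rw [hfg]
    exact (hsub _ _).trans (by rw [hhom _ hd.le])
  have htv : tv w f = tv w g + (f a - f b) * cutF w A := by
    rw [← tv_indic_eq_cut w hwsym]
    unfold tv
    have : ∀ i j, w i j * |f i - f j| = w i j * |g i - g j| +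
        (f a - f b) * (w i j * |indic A i - indic A j|) := by
      intro i j
      have : |f i - f j| = |g i - g j| + (f a - f b) * |indic A i - indic A j| := by
        rcases hcase i with h | h <;> rcases hcase j with h' | h'
        · simp [hg, indic, hA, h, h', hba]
        · simp only [hg, indic, hA, h, h', hba, not_lt.2 h', mem_filter, mem_univ, true_and,
            if_true, if_false, min_eq_left, min_eq_right hba.le, sub_zero, abs_one]
          rw [abs_of_nonneg (by linarith), abs_of_nonneg (by linarith)]; ring
        · simp only [hg, indic, hA, h, h', hba, not_lt.2 h, mem_filter, mem_univ, true_and,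
            if_true, if_false, min_eq_left, min_eq_right hba.le, zero_sub, abs_neg, abs_one]
          rw [abs_of_nonpos (by linarith), abs_of_nonpos (by linarith)]; ring
        · simp [hg, indic, hA, h, h', not_lt.2 h, not_lt.2 h']
      rw [this]; ring
    simp_rw [this, Finset.sum_add_distrib, ← Finset.mul_sum]
    ring
  have hAlt : l * S (indic A) < cutF w A := by
    refine hlev (f b) ⟨a, by simpa using hba⟩ ?_
    intro h
    have : b ∈ univ.filter fun i => f b < f i := by rw [h]; exact mem_univ b
    simp at this
  have hgle : l * S g ≤ tv w g := by
    have hcard : (univ.image g).card < N := by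
      rw [← hN]
      apply Finset.card_lt_card
      rw [Finset.ssubset_iff_of_subset]
      · refine ⟨f a, mem_image_of_mem _ (mem_univ _), ?_⟩
        intro h
        obtain ⟨i, -, hi⟩ := mem_image.1 h
        have : g i ≤ f b := min_le_right _ _
        linarith
      · intro x hx
        obtain ⟨i, -, rfl⟩ := mem_image.1 hx
        rcases min_choice (f i) (f b) with h | h <;> simp only [hg, h] <;>
          exact mem_image_of_mem _ (mem_univ _)
    have hlev' : ∀ t : ℝ, (univ.filter fun i => t < g i).Nonempty →
        (univ.filter fun i => t < g i) ≠ univ →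
        l * S (indic (univ.filter fun i => t < g i)) < cutF w (univ.filter fun i => t < g i) := by
      intro t ht1 ht2
      have htb : t < f b := by
        obtain ⟨i, hi⟩ := ht1
        exact (lt_min_iff.1 (mem_filter.1 hi).2).2
      have heq : (univ.filter fun i => t < g i) = univ.filter fun i => t < f i := by
        ext i; simp [hg, htb]
      rw [heq] at ht1 ht2 ⊢
      exact hlev t ht1 ht2
    rcases ih _ hcard g rfl hlev' with ⟨c, h⟩ | h
    · rw [h, hc]; simp [tv]
    · exact h.le
  rw [htv]
  have h1 := mul_le_mul_of_nonneg_left hSf hl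
  have h2 := mul_lt_mul_of_pos_left hAlt hd
  nlinarith

/-- exact relaxation of balanced graph cuts for a convex, even,
one-homogeneous, translation-invariant balancing function `S`, with `Ŝ A := S (1_A)`. -/
theorem exact_relaxation_convex_balancing {n : ℕ} (hn : 2 ≤ n)
    (w : Fin n → Fin n → ℝ)
    (hwsym : ∀ i j, w i j = w j i) (hwnonneg : ∀ i j, 0 ≤ w i j)
    (S : (Fin n → ℝ) → ℝ)
    (hconv : ConvexOn ℝ Set.univ S)
    (heven : ∀ f, S (-f) = S f)
    (hhom : PosOneHom S)
    (htrans : ∀ (f : Fin n → ℝ) (α : ℝ), S (fun i => f i + α) = S f)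
    (hpos : ∀ A : Finset (Fin n), A.Nonempty → A ≠ Finset.univ → 0 < S (indic A)) :
    (∃ A₀ : Finset (Fin n), A₀.Nonempty ∧ A₀ ≠ Finset.univ ∧
      (∀ A : Finset (Fin n), A.Nonempty → A ≠ Finset.univ →
        cutF w A₀ / S (indic A₀) ≤ cutF w A / S (indic A)) ∧
      IsLeast ((fun f => tv w f / S f) '' {f | S f ≠ 0}) (cutF w A₀ / S (indic A₀))) ∧
    (∀ f : Fin n → ℝ, S f ≠ 0 → ∃ t : ℝ,
      (Finset.univ.filter fun i => t < f i).Nonempty ∧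
      (Finset.univ.filter fun i => t < f i) ≠ Finset.univ ∧
      cutF w (Finset.univ.filter fun i => t < f i) /
          S (indic (Finset.univ.filter fun i => t < f i)) ≤ tv w f / S f) := by
  have h0 : S 0 = 0 := by simpa using hhom 0 le_rfl 0
  have hsub : ∀ f g, S (f + g) ≤ S f + S g := by
    intro f g
    have h := hconv.2 (Set.mem_univ f) (Set.mem_univ g)
      (show (0 : ℝ) ≤ 1 / 2 by norm_num) (show (0 : ℝ) ≤ 1 / 2 by norm_num) (by norm_num)
    rw [← smul_add, hhom _ (by norm_num)] at h
    simp only [smul_eq_mul] at h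
    linarith
  have hnn : ∀ f, 0 ≤ S f := by
    intro f
    have h := hsub f (-f)
    rw [heven, add_neg_cancel, h0] at h
    linarith
  have hc : ∀ c : ℝ, S (fun _ => c) = 0 := by
    intro c
    have h := htrans 0 c
    rw [h0] at h
    simpa using h
  have htvnn : ∀ f, 0 ≤ tv w f := fun f => by
    unfold tv
    exact mul_nonneg (by norm_num) (Finset.sum_nonneg fun i _ => Finset.sum_nonneg fun j _ =>
      mul_nonneg (hwnonneg i j) (abs_nonneg _))
  have part2 : ∀ f : Fin n → ℝ, S f ≠ 0 → ∃ t : ℝ,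
      (Finset.univ.filter fun i => t < f i).Nonempty ∧
      (Finset.univ.filter fun i => t < f i) ≠ Finset.univ ∧
      cutF w (Finset.univ.filter fun i => t < f i) /
          S (indic (Finset.univ.filter fun i => t < f i)) ≤ tv w f / S f := by
    intro f hf
    have hfpos : 0 < S f := lt_of_le_of_ne (hnn f) (Ne.symm hf)
    by_contra! hcon
    rcases level_key w hwsym S hsub hhom hc (tv w f / S f) (div_nonneg (htvnn f) hfpos.le) _ f rfl
      (fun t h1 h2 => (lt_div_iff₀ (hpos _ h1 h2)).1 (hcon t h1 h2)) with ⟨c, h⟩ | h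
    · exact hf (by rw [h, hc])
    · rw [div_mul_cancel₀ _ hf] at h
      exact lt_irrefl _ h
  refine ⟨?_, part2⟩
  have hPne : (univ.filter fun A : Finset (Fin n) => A.Nonempty ∧ A ≠ univ).Nonempty := by
    refine ⟨{⟨0, by omega⟩}, ?_⟩
    simp only [mem_filter, mem_univ, true_and, singleton_nonempty]
    intro h
    have := congrArg Finset.card h
    simp at this
    omega
  obtain ⟨A₀, hA₀, hmin⟩ := Finset.exists_min_image _ (fun A => cutF w A / S (indic A)) hPne
  obtain ⟨-, hA1, hA2⟩ := mem_filter.1 hA₀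
  have hmin' : ∀ A : Finset (Fin n), A.Nonempty → A ≠ Finset.univ →
      cutF w A₀ / S (indic A₀) ≤ cutF w A / S (indic A) :=
    fun A h1 h2 => hmin A (mem_filter.2 ⟨mem_univ _, h1, h2⟩)
  refine ⟨A₀, hA1, hA2, hmin', ⟨indic A₀, (hpos A₀ hA1 hA2).ne', ?_⟩, ?_⟩
  · simp only [tv_indic_eq_cut w hwsym]
  · rintro _ ⟨f, hf, rfl⟩
    obtain ⟨t, h1, h2, h3⟩ := part2 f hf
    exact (hmin' _ h1 h2).trans h3
end

section
/- Let (V,w) be a finite undirected weighted graph and Ŝ : 2^V → ℝ a nonnegative symmetric set function (Ŝ(A) = Ŝ(Ā) for all A) with Ŝ(∅) = 0 and Ŝ(A) > 0 for every A with ∅ ≠ A ⊊ V, and let S be the Lovasz extension of Ŝ. Then inf over all f ∈ ℝ^V with S(f) ≠ 0 of TV(f)/S(f) equals the minimum over all A with ∅ ≠ A ⊊ V of cut(A,Ā)/Ŝ(A). Moreover, for every f ∈ ℝ^V with S(f) ≠ 0 there exists t ∈ ℝ such that C_t := {i ∈ V : f_i > t} satisfies ∅ ≠ C_t ⊊ V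 and cut(C_t, C̄_t)/Ŝ(C_t) ≤ TV(f)/S(f). -/
open Finset Filter

lemma lovasz_abel {m : ℕ} (H : Finset (Fin (m+1)) → ℝ) (f : Fin (m+1) → ℝ)
    (h0 : H ∅ = 0) (h1 : H Finset.univ = 0) :
    lovasz H f = ∑ k : Fin m,
      (f (Tuple.sort f k.succ) - f (Tuple.sort f k.castSucc)) *
      H (Finset.univ.filter fun j => (k : ℕ) + 1 ≤ ((Tuple.sort f).symm j : ℕ)) := by
  unfold lovasz
  simp only [mul_sub, Finset.sum_sub_distrib, sub_mul]
  congr 1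
  · rw [Fin.sum_univ_succ]
    simp [h1]
  · rw [Fin.sum_univ_castSucc]
    have : (Finset.univ.filter fun j : Fin (m+1) =>
        m + 1 ≤ ((Tuple.sort f).symm j : ℕ)) = ∅ := by
      apply Finset.filter_eq_empty_iff.2
      intro j _
      have := ((Tuple.sort f).symm j).2
      omega
    simp only [Fin.val_last, this, h0, Fin.val_castSucc, mul_zero, add_zero]

lemma level_eq {m : ℕ} (f : Fin (m+1) → ℝ) (k : Fin m)
    (h : f (Tuple.sort f k.castSucc) < f (Tuple.sort f k.succ)) :
    (Finset.univ.filter fun j => (k : ℕ) + 1 ≤ ((Tuple.sort f).symm j : ℕ)) =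
    Finset.univ.filter fun j => f (Tuple.sort f k.castSucc) < f j := by
  have hm := Tuple.monotone_sort f
  ext j
  simp only [Finset.mem_filter, Finset.mem_univ, true_and]
  constructor
  · intro hj
    have : k.succ ≤ (Tuple.sort f).symm j := by
      rw [Fin.le_def]; simpa using hj
    have := hm this
    simp at this
    linarith
  · intro hj
    by_contra hc
    have : (Tuple.sort f).symm j ≤ k.castSucc := by
      rw [Fin.le_def]; simp; omega
    have := hm this
    simp at this
    linarith

lemma level_nontriv {m : ℕ} (f : Fin (m+1) → ℝ) (k : Fin m)
    (h : f (Tuple.sort f k.castSucc) < f (Tuple.sort f k.succ)) :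
    (Finset.univ.filter fun j => f (Tuple.sort f k.castSucc) < f j).Nonempty ∧
    (Finset.univ.filter fun j => f (Tuple.sort f k.castSucc) < f j) ≠ Finset.univ := by
  refine ⟨⟨Tuple.sort f k.succ, by simpa using h⟩, fun hu => ?_⟩
  have := Finset.mem_univ (Tuple.sort f k.castSucc)
  rw [← hu] at this
  simp at this

lemma lovasz_nonneg {m : ℕ} (H : Finset (Fin (m+1)) → ℝ) (f : Fin (m+1) → ℝ)
    (h0 : H ∅ = 0) (h1 : H Finset.univ = 0)
    (hH : ∀ t : ℝ, (Finset.univ.filter fun i => t < f i).Nonempty →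
      (Finset.univ.filter fun i => t < f i) ≠ Finset.univ →
      0 ≤ H (Finset.univ.filter fun i => t < f i)) : 0 ≤ lovasz H f := by
  rw [lovasz_abel H f h0 h1]
  refine Finset.sum_nonneg fun k _ => ?_
  have hle : f (Tuple.sort f k.castSucc) ≤ f (Tuple.sort f k.succ) :=
    Tuple.monotone_sort f (Fin.castSucc_lt_succ (i := k)).le
  rcases hle.eq_or_lt with h | h
  · simp [h]
  · rw [level_eq f k h]
    have := level_nontriv f k h
    exact mul_nonneg (by linarith) (hH _ this.1 this.2)

lemma lovasz_pos {m : ℕ} (H : Finset (Fin (m+1)) → ℝ) (f : Fin (m+1) → ℝ)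
    (h0 : H ∅ = 0) (h1 : H Finset.univ = 0)
    (hf : ∃ k : Fin m, f (Tuple.sort f k.castSucc) < f (Tuple.sort f k.succ))
    (hH : ∀ t : ℝ, (Finset.univ.filter fun i => t < f i).Nonempty →
      (Finset.univ.filter fun i => t < f i) ≠ Finset.univ →
      0 < H (Finset.univ.filter fun i => t < f i)) : 0 < lovasz H f := by
  rw [lovasz_abel H f h0 h1]
  have key : ∀ k : Fin m, f (Tuple.sort f k.castSucc) < f (Tuple.sort f k.succ) →
      0 < (f (Tuple.sort f k.succ) - f (Tuple.sort f k.castSucc)) *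
      H (Finset.univ.filter fun j => (k : ℕ) + 1 ≤ ((Tuple.sort f).symm j : ℕ)) := by
    intro k h
    rw [level_eq f k h]
    have := level_nontriv f k h
    exact mul_pos (by linarith) (hH _ this.1 this.2)
  obtain ⟨k, hk⟩ := hf
  refine Finset.sum_pos' (fun k _ => ?_) ⟨k, Finset.mem_univ _, key k hk⟩
  have hle : f (Tuple.sort f k.castSucc) ≤ f (Tuple.sort f k.succ) :=
    Tuple.monotone_sort f (Fin.castSucc_lt_succ (i := k)).le
  rcases hle.eq_or_lt with h | h
  · simp [h]
  · exact (key k h).le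

lemma exists_jump {m : ℕ} (H : Finset (Fin (m+1)) → ℝ) (f : Fin (m+1) → ℝ)
    (h0 : H ∅ = 0) (h1 : H Finset.univ = 0) (h : lovasz H f ≠ 0) :
    ∃ k : Fin m, f (Tuple.sort f k.castSucc) < f (Tuple.sort f k.succ) := by
  by_contra! hc
  apply h
  rw [lovasz_abel H f h0 h1]
  refine Finset.sum_eq_zero fun k _ => ?_
  have hle : f (Tuple.sort f k.castSucc) ≤ f (Tuple.sort f k.succ) :=
    Tuple.monotone_sort f (Fin.castSucc_lt_succ (i := k)).le
  rw [le_antisymm hle (hc k)]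
  simp

lemma exists_jump' {m : ℕ} (f : Fin (m+1) → ℝ) (i j : Fin (m+1)) (h : f i ≠ f j) :
    ∃ k : Fin m, f (Tuple.sort f k.castSucc) < f (Tuple.sort f k.succ) := by
  by_contra! hc
  have hcon : ∀ k : Fin (m+1), f (Tuple.sort f k) = f (Tuple.sort f 0) := by
    intro k
    induction k using Fin.induction with
    | zero => rfl
    | succ k ih =>
      rw [← ih]
      exact le_antisymm (hc k)
        (Tuple.monotone_sort f (Fin.castSucc_lt_succ (i := k)).le)
  apply h
  have hi := hcon ((Tuple.sort f).symm i)
  have hj := hcon ((Tuple.sort f).symm j)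
  simp only [Equiv.apply_symm_apply] at hi hj
  rw [hi, hj]

lemma cutF_eq {n : ℕ} (w : Fin n → Fin n → ℝ) (A : Finset (Fin n)) :
    cutF w A = ∑ i, ∑ j, w i j * (if i ∈ A ∧ j ∉ A then 1 else 0) := by
  unfold cutF
  rw [← Finset.sum_filter_add_sum_filter_not Finset.univ (· ∈ A)]
  have h2 : ∑ i ∈ Finset.univ.filter (fun i => ¬ i ∈ A),
      ∑ j, w i j * (if i ∈ A ∧ j ∉ A then (1:ℝ) else 0) = 0 := by
    refine Finset.sum_eq_zero fun i hi => Finset.sum_eq_zero fun j _ => ?_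
    simp at hi
    simp [hi]
  rw [h2, add_zero]
  refine Finset.sum_congr (by ext; simp) fun i hi => ?_
  rw [← Finset.sum_filter_add_sum_filter_not Finset.univ (· ∈ A)
    (fun j => w i j * (if i ∈ A ∧ j ∉ A then (1:ℝ) else 0))]
  have h3 : ∑ j ∈ Finset.univ.filter (fun j => j ∈ A),
      w i j * (if i ∈ A ∧ j ∉ A then (1:ℝ) else 0) = 0 := by
    refine Finset.sum_eq_zero fun j hj => ?_
    simp at hj
    simp [hj]
  have hi' : i ∈ A := by simpa using hi
  rw [h3, zero_add]
  refine Finset.sum_congr (by ext; simp) fun j hj => ?_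
  have hj' : j ∉ A := by simpa using hj
  simp [hi', hj']

lemma pair_sum {n : ℕ} (f : Fin n → ℝ) (i j : Fin n) :
    ∑ k : Fin n, f (Tuple.sort f k) *
      ((if (k : ℕ) ≤ ((Tuple.sort f).symm i : ℕ) ∧ ¬ (k : ℕ) ≤ ((Tuple.sort f).symm j : ℕ)
          then (1:ℝ) else 0) -
       (if (k : ℕ) + 1 ≤ ((Tuple.sort f).symm i : ℕ) ∧
          ¬ (k : ℕ) + 1 ≤ ((Tuple.sort f).symm j : ℕ) then (1:ℝ) else 0)) =
    max (f i - f j) 0 := by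
  have hm := Tuple.monotone_sort f
  have hi : f (Tuple.sort f ((Tuple.sort f).symm i)) = f i := by simp
  have hj : f (Tuple.sort f ((Tuple.sort f).symm j)) = f j := by simp
  generalize (Tuple.sort f).symm i = p at *
  generalize (Tuple.sort f).symm j = q at *
  rcases lt_or_ge q p with h | h
  · have : f j ≤ f i := by rw [← hi, ← hj]; exact hm h.le
    rw [max_eq_left (by linarith)]
    have e : ∀ k : Fin n, ((if (k : ℕ) ≤ (p : ℕ) ∧ ¬ (k : ℕ) ≤ (q : ℕ) then (1:ℝ) else 0) -
       (if (k : ℕ) + 1 ≤ (p : ℕ) ∧ ¬ (k : ℕ) + 1 ≤ (q : ℕ) then (1:ℝ) else 0)) =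
       (if k = p then 1 else 0) - (if k = q then 1 else 0) := by
      intro k
      rw [Fin.lt_def] at h
      simp only [Fin.ext_iff]
      split_ifs <;> first | omega | norm_num
    simp only [e, mul_sub, Finset.sum_sub_distrib, mul_ite, mul_one, mul_zero,
      Finset.sum_ite_eq', Finset.mem_univ, if_true, hi, hj]
  · have : f i ≤ f j := by rw [← hi, ← hj]; exact hm h
    rw [max_eq_right (by linarith)]
    refine Finset.sum_eq_zero fun k _ => ?_
    rw [Fin.le_def] at h
    rw [if_neg (by omega), if_neg (by omega)]
    simp

lemma tv_eq_lovasz {n : ℕ} (w : Fin n → Fin n → ℝ) (hwsym : ∀ i j, w i j = w j i)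
    (f : Fin n → ℝ) : tv w f = lovasz (cutF w) f := by
  have h1 : lovasz (cutF w) f = ∑ i, ∑ j, w i j * max (f i - f j) 0 := by
    unfold lovasz
    simp only [cutF_eq, ← Finset.sum_sub_distrib, ← mul_sub, Finset.mul_sum,
      Finset.mem_filter, Finset.mem_univ, true_and]
    rw [Finset.sum_comm]
    refine Finset.sum_congr rfl fun i _ => ?_
    rw [Finset.sum_comm]
    refine Finset.sum_congr rfl fun j _ => ?_
    rw [← pair_sum f i j, Finset.mul_sum]
    refine Finset.sum_congr rfl fun k _ => ?_
    ring
  have h2 : ∑ i, ∑ j, w i j * max (f i - f j) 0 = ∑ i, ∑ j, w i j * max (f j - f i) 0 := by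
    rw [Finset.sum_comm]
    refine Finset.sum_congr rfl fun i _ => Finset.sum_congr rfl fun j _ => ?_
    rw [hwsym]
  have h3 : ∑ i, ∑ j, w i j * |f i - f j| = ∑ i, ∑ j, w i j * max (f i - f j) 0 +
      ∑ i, ∑ j, w i j * max (f j - f i) 0 := by
    simp only [← Finset.sum_add_distrib]
    refine Finset.sum_congr rfl fun i _ => Finset.sum_congr rfl fun j _ => ?_
    rw [← mul_add]
    congr 1
    rcases le_total (f i) (f j) with h | h
    · rw [abs_of_nonpos (by linarith), max_eq_right (by linarith), max_eq_left (by linarith)]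
      ring
    · rw [abs_of_nonneg (by linarith), max_eq_left (by linarith), max_eq_right (by linarith)]
      ring
  unfold tv
  rw [h3, ← h2, h1]
  ring

lemma lovasz_comb {n : ℕ} (H K : Finset (Fin n) → ℝ) (a b : ℝ) (f : Fin n → ℝ) :
    lovasz (fun A => a * H A - b * K A) f = a * lovasz H f - b * lovasz K f := by
  unfold lovasz
  simp only [Finset.mul_sum, ← Finset.sum_sub_distrib]
  refine Finset.sum_congr rfl fun k _ => ?_
  ring

/-- exact relaxation of balanced graph cuts where the balancing function
is the Lovasz extension of a nonnegative symmetric set function `Ŝ` with `Ŝ ∅ = 0`. -/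
theorem exact_relaxation_lovasz_balancing {n : ℕ} (hn : 2 ≤ n)
    (w : Fin n → Fin n → ℝ)
    (hwsym : ∀ i j, w i j = w j i) (hwnonneg : ∀ i j, 0 ≤ w i j)
    (Shat : Finset (Fin n) → ℝ)
    (hnonneg : ∀ A, 0 ≤ Shat A)
    (hsym : ∀ A, Shat Aᶜ = Shat A)
    (hempty : Shat ∅ = 0)
    (hpos : ∀ A : Finset (Fin n), A.Nonempty → A ≠ Finset.univ → 0 < Shat A) :
    (∃ A₀ : Finset (Fin n), A₀.Nonempty ∧ A₀ ≠ Finset.univ ∧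
      (∀ A : Finset (Fin n), A.Nonempty → A ≠ Finset.univ →
        cutF w A₀ / Shat A₀ ≤ cutF w A / Shat A) ∧
      IsLeast ((fun f => tv w f / lovasz Shat f) '' {f | lovasz Shat f ≠ 0})
        (cutF w A₀ / Shat A₀)) ∧
    (∀ f : Fin n → ℝ, lovasz Shat f ≠ 0 → ∃ t : ℝ,
      (Finset.univ.filter fun i => t < f i).Nonempty ∧
      (Finset.univ.filter fun i => t < f i) ≠ Finset.univ ∧
      cutF w (Finset.univ.filter fun i => t < f i) /
          Shat (Finset.univ.filter fun i => t < f i) ≤ tv w f / lovasz Shat f) := by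
  obtain ⟨m, rfl⟩ : ∃ m, n = m + 1 := ⟨n - 1, by omega⟩
  have hc0 : cutF w ∅ = 0 := by simp [cutF]
  have hc1 : cutF w Finset.univ = 0 := by simp [cutF]
  have hs1 : Shat Finset.univ = 0 := by rw [← hempty, ← hsym ∅]; simp
  have part2 : ∀ f : Fin (m+1) → ℝ, lovasz Shat f ≠ 0 → ∃ t : ℝ,
      (Finset.univ.filter fun i => t < f i).Nonempty ∧
      (Finset.univ.filter fun i => t < f i) ≠ Finset.univ ∧
      cutF w (Finset.univ.filter fun i => t < f i) /
          Shat (Finset.univ.filter fun i => t < f i) ≤ tv w f / lovasz Shat f := by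
    intro f hf
    by_contra! hcon
    have hp := lovasz_pos
      (fun A => 1 * cutF w A - (tv w f / lovasz Shat f) * Shat A) f
      (by simp [hc0, hempty]) (by simp [hc1, hs1]) (exists_jump Shat f hempty hs1 hf)
      (by
        intro t h1 h2
        have := hcon t h1 h2
        rw [lt_div_iff₀ (hpos _ h1 h2)] at this
        linarith)
    rw [lovasz_comb, ← tv_eq_lovasz w hwsym, div_mul_cancel₀ _ hf] at hp
    linarith
  refine ⟨?_, part2⟩
  have hne : ((Finset.univ : Finset (Finset (Fin (m+1)))).filter
      fun A => A.Nonempty ∧ A ≠ Finset.univ).Nonempty := by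
    refine ⟨{0}, ?_⟩
    simp only [Finset.mem_filter, Finset.mem_univ, true_and]
    refine ⟨Finset.singleton_nonempty _, fun h => ?_⟩
    have := congrArg Finset.card h
    simp at this
    omega
  obtain ⟨A₀, hA, hmin⟩ := Finset.exists_min_image _ (fun A => cutF w A / Shat A) hne
  simp only [Finset.mem_filter, Finset.mem_univ, true_and] at hA hmin
  refine ⟨A₀, hA.1, hA.2, fun A h1 h2 => hmin A ⟨h1, h2⟩, ?_, ?_⟩
  · have hlev : ∀ t : ℝ, (Finset.univ.filter fun i => t < indic A₀ i).Nonempty →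
        (Finset.univ.filter fun i => t < indic A₀ i) ≠ Finset.univ →
        (Finset.univ.filter fun i => t < indic A₀ i) = A₀ := by
      intro t h1 h2
      obtain ⟨i, hi⟩ := h1
      have ht1 : t < 1 := by
        simp only [Finset.mem_filter, Finset.mem_univ, true_and] at hi
        unfold indic at hi
        split_ifs at hi <;> linarith
      have ht0 : 0 ≤ t := by
        by_contra! hlt
        apply h2
        apply Finset.filter_true_of_mem
        intro j _
        unfold indic
        split_ifs <;> linarith
      ext j
      simp only [Finset.mem_filter, Finset.mem_univ, true_and]
      unfold indic
      split_ifs with hj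
      · simp [hj, ht1]
      · simp [hj, ht0]
    have hjump : ∃ k : Fin m, indic A₀ (Tuple.sort (indic A₀) k.castSucc) <
        indic A₀ (Tuple.sort (indic A₀) k.succ) := by
      obtain ⟨i, hi⟩ := hA.1
      obtain ⟨j, hj⟩ : ∃ j, j ∉ A₀ := by
        by_contra! h
        exact hA.2 (Finset.eq_univ_iff_forall.2 h)
      exact exists_jump' _ i j (by simp [indic, hi, hj])
    have hSA := hpos A₀ hA.1 hA.2
    have hSp : 0 < lovasz Shat (indic A₀) :=
      lovasz_pos Shat _ hempty hs1 hjump fun t h1 h2 => hpos _ h1 h2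
    have e1 := lovasz_nonneg (fun A => Shat A₀ * cutF w A - cutF w A₀ * Shat A) (indic A₀)
      (by simp [hc0, hempty]) (by simp [hc1, hs1])
      (by intro t h1 h2; rw [hlev t h1 h2]; linarith)
    have e2 := lovasz_nonneg (fun A => cutF w A₀ * Shat A - Shat A₀ * cutF w A) (indic A₀)
      (by simp [hc0, hempty]) (by simp [hc1, hs1])
      (by intro t h1 h2; rw [hlev t h1 h2]; linarith)
    rw [lovasz_comb, ← tv_eq_lovasz w hwsym] at e1 e2
    refine ⟨indic A₀, hSp.ne', ?_⟩
    show tv w (indic A₀) / lovasz Shat (indic A₀) = _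
    rw [div_eq_div_iff hSp.ne' hSA.ne']
    linarith
  · rintro _ ⟨f, hf, rfl⟩
    obtain ⟨t, h1, h2, h3⟩ := part2 f hf
    exact (hmin _ ⟨h1, h2⟩).trans h3
end

section
/- Let f ∈ ℝ^V with G(f) = 1 and S(f) ≠ 0, let c ≥ 0, fix subgradients r₂ ∈ ∂R₂(f), s₁ ∈ ∂S₁(f), g ∈ ∂G(f), and define Φ'(u) := Φ_f^c(u) + c·G(u). Then every minimizer of Φ_f^c over the set {u ∈ ℝ^V : G(u) ≤ 1} is also a minimizer of Φ' over {u ∈ ℝ^V : G(u) ≤ 1}. -/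
open Finset Filter

/-- every minimizer of `Φ_f^c` over `{u : G u ≤ 1}` also minimizes
`Φ' = Φ_f^c + c·G` over `{u : G u ≤ 1}`. -/
theorem minimizer_of_Phi_minimizes_Phi_prime {V : Type*} [Fintype V] (p : ℝ) (hp : 1 ≤ p)
    (R1 R2 S1 S2 G : (V → ℝ) → ℝ)
    (hR1conv : ConvexOn ℝ Set.univ R1) (hR2conv : ConvexOn ℝ Set.univ R2)
    (hS1conv : ConvexOn ℝ Set.univ S1) (hS2conv : ConvexOn ℝ Set.univ S2)
    (hR1hom : PosOneHom R1) (hR2hom : PosOneHom R2)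
    (hS1hom : PosOneHom S1) (hS2hom : PosOneHom S2)
    (hRnonneg : ∀ u, 0 ≤ R1 u - R2 u) (hSnonneg : ∀ u, 0 ≤ S1 u - S2 u)
    (hGconv : ConvexOn ℝ Set.univ G) (hGnonneg : ∀ u, 0 ≤ G u)
    (hGhom : PosPHom p G) (hGzero : ∀ u, G u = 0 ↔ u = 0)
    (f : V → ℝ) (hGf : G f = 1) (hSf : S1 f - S2 f ≠ 0)
    (c : ℝ) (hc : 0 ≤ c)
    (r2 : V → ℝ) (hr2 : r2 ∈ subdiff R2 f)
    (s1 : V → ℝ) (hs1 : s1 ∈ subdiff S1 f)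
    (g : V → ℝ) (hg : g ∈ subdiff G f)
    (m : V → ℝ) (hm : G m ≤ 1)
    (hmin : ∀ u, G u ≤ 1 →
      Phi R1 R2 S1 S2 f r2 s1 g c m ≤ Phi R1 R2 S1 S2 f r2 s1 g c u) :
    ∀ u, G u ≤ 1 →
      Phi R1 R2 S1 S2 f r2 s1 g c m + c * G m ≤
        Phi R1 R2 S1 S2 f r2 s1 g c u + c * G u := by
  intro u hu
  have hsm : ∀ (ν : ℝ) (a b : V → ℝ), ip (ν • a) b = ν * ip a b := by
    intro ν a b
    simp only [ip, Finset.mul_sum, Pi.smul_apply, smul_eq_mul, mul_assoc]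
  have hcomm : ∀ a b : V → ℝ, ip a b = ip b a := by
    intro a b
    simp only [ip, mul_comm]
  have hsub : ∀ (ν : ℝ) (a : V → ℝ), ip a (ν • f - f) = (ν - 1) * ip f a := by
    intro ν a
    rw [← hsm, hcomm a, sub_smul, one_smul]
  have hPhi : ∀ ν : ℝ, 0 ≤ ν → ∀ v, Phi R1 R2 S1 S2 f r2 s1 g c (ν • v)
      = ν * Phi R1 R2 S1 S2 f r2 s1 g c v := by
    intro ν hν v
    simp only [Phi, hsm, hR1hom ν hν, hS2hom ν hν]
    ring
  have h1 : R2 f ≤ ip f r2 := by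
    have h := hr2 ((0 : ℝ) • f)
    rw [hsub, hR2hom 0 le_rfl] at h
    linarith
  have h2 : S1 f ≤ ip f s1 := by
    have h := hs1 ((0 : ℝ) • f)
    rw [hsub, hS1hom 0 le_rfl] at h
    linarith
  have h3 : ip f g = p := by
    have hd : HasDerivAt (fun ν : ℝ => ν ^ p - (ν - 1) * ip f g) (p - ip f g) 1 := by
      have e1 := Real.hasDerivAt_rpow_const (x := 1) (p := p) (Or.inl one_ne_zero)
      have e2 := ((hasDerivAt_id (1 : ℝ)).sub_const 1).mul_const (ip f g)
      have e3 := e1.sub e2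
      rw [Real.one_rpow, mul_one, one_mul] at e3
      exact e3
    have hl : IsLocalMin (fun ν : ℝ => ν ^ p - (ν - 1) * ip f g) 1 := by
      filter_upwards [lt_mem_nhds (zero_lt_one : (0 : ℝ) < 1)] with ν hν
      have h := hg (ν • f)
      rw [hsub, hGhom ν hν.le, hGf] at h
      simp only [Real.one_rpow, sub_self, zero_mul]
      linarith
    have := hl.hasDerivAt_eq_zero hd
    linarith
  have hF : 0 ≤ (R1 f - R2 f) / (S1 f - S2 f) := div_nonneg (hRnonneg f) (hSnonneg f)
  have hPf : Phi R1 R2 S1 S2 f r2 s1 g c f ≤ - (c * p) := by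
    have e : (R1 f - R2 f) / (S1 f - S2 f) * (S1 f - S2 f) = R1 f - R2 f :=
      div_mul_cancel₀ _ hSf
    have e2 := mul_le_mul_of_nonneg_left h2 hF
    simp only [Phi, h3]
    nlinarith
  have hmu := (hmin f hGf.le).trans hPf
  have hp0 : p ≠ 0 := by linarith
  obtain ⟨t, ht⟩ : ∃ t, t = G u ^ p⁻¹ := ⟨_, rfl⟩
  have ht0 : 0 ≤ t := ht ▸ Real.rpow_nonneg (hGnonneg u) _
  have ht1 : t ≤ 1 := ht ▸ Real.rpow_le_one (hGnonneg u) hu (by positivity)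
  have htp : t ^ p = G u := by rw [ht, Real.rpow_inv_rpow (hGnonneg u) hp0]
  have hlow : t * Phi R1 R2 S1 S2 f r2 s1 g c m ≤ Phi R1 R2 S1 S2 f r2 s1 g c u := by
    rcases ht0.eq_or_lt with h | h
    · have hG0 : G u = 0 := by rw [← htp, ← h, Real.zero_rpow hp0]
      have hu0 := (hGzero u).1 hG0
      have := hPhi 0 le_rfl u
      rw [zero_smul, ← hu0] at this
      rw [this, ← h]
      simp
    · have hv : G (t⁻¹ • u) ≤ 1 := by
        rw [hGhom _ (inv_nonneg.2 ht0), ← htp, ← Real.mul_rpow (inv_nonneg.2 ht0) ht0,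
          inv_mul_cancel₀ h.ne', Real.one_rpow]
      have h4 := mul_le_mul_of_nonneg_left (hmin _ hv) ht0
      rwa [← hPhi t ht0 (t⁻¹ • u), smul_inv_smul₀ h.ne'] at h4
  have hB : 1 + p * (t - 1) ≤ G u := by
    have := one_add_mul_self_le_rpow_one_add (s := t - 1) (by linarith) hp
    rw [← htp]
    simpa using this
  have hcB := mul_le_mul_of_nonneg_left hB hc
  have hcm := mul_le_mul_of_nonneg_left hm hc
  nlinarith [mul_nonneg (sub_nonneg.2 ht1) (sub_nonneg.2 hmu)]
end

section
/- Let f ∈ ℝ^V with G(f) = 1 and S(f) ≠ 0, let c ≥ 0, fix subgradients r₂ ∈ ∂R₂(f), s₁ ∈ ∂S₁(f), g ∈ ∂G(f), and define Φ'(u) := Φ_f^c(u) + c·G(u). Then: (1) if p > 1 and c > 0, Φ' attains a global minimum over ℝ^V and there exists ν ≥ 1 such that for every minimizer f⁺ of Φ_f^c over {u : G(u) ≤ 1}, the vector ν·f⁺ is a global minimizer of Φ' over ℝ^V; (2) if f itself is a minimizer of Φ_f^c over {u : G(u) ≤ 1}, then every minimizer of Φ_f^c over {u : G(u) ≤ 1}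 is a global minimizer of Φ' over ℝ^V. -/
open Finset Filter

lemma aux_rpow_tangent (p ν t : ℝ) (hp : 1 ≤ p) (hν : 0 < ν) (ht : 0 ≤ t) :
    ν ^ p + p * ν ^ (p - 1) * (t - ν) ≤ t ^ p := by
  have h := one_add_mul_self_le_rpow_one_add (s := t / ν - 1) (by
    have : 0 ≤ t / ν := by positivity
    linarith) hp
  have h2 : (1 + (t / ν - 1)) = t / ν := by ring
  rw [h2, Real.div_rpow ht hν.le, le_div_iff₀ (Real.rpow_pos_of_pos hν p)] at h
  have h3 : ν ^ p = ν ^ (p - 1) * ν := by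
    rw [← Real.rpow_add_one hν.ne']; congr 1; ring
  rw [h3] at h ⊢
  calc _ = (1 + p * (t / ν - 1)) * (ν ^ (p - 1) * ν) := by field_simp
    _ ≤ _ := h

lemma aux_ip_smul {V : Type*} [Fintype V] (a : ℝ) (u v : V → ℝ) :
    ip (a • u) v = a * ip u v := by
  simp [ip, Finset.mul_sum, mul_assoc]

lemma aux_ip_comm {V : Type*} [Fintype V] (u v : V → ℝ) : ip u v = ip v u := by
  simp [ip, mul_comm]

lemma aux_euler {V : Type*} [Fintype V] (p : ℝ) (hp : 1 ≤ p) (A : (V → ℝ) → ℝ)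
    (hA : PosPHom p A) (f a : V → ℝ) (ha : a ∈ subdiff A f) : ip f a = p * A f := by
  have key : ∀ t : ℝ, 0 ≤ t → A f + (t - 1) * ip f a ≤ t ^ p * A f := by
    intro t ht
    have h := ha (t • f)
    rw [hA t ht, aux_ip_comm, show t • f - f = (t - 1) • f by rw [sub_smul, one_smul],
      aux_ip_smul] at h
    exact h
  have hd : HasDerivAt (fun t : ℝ => t ^ p * A f - (t - 1) * ip f a)
      (p * A f - ip f a) 1 := by
    have h1 := (Real.hasDerivAt_rpow_const (x := 1) (p := p) (Or.inl one_ne_zero)).mul_const (A f)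
    have h2 := ((hasDerivAt_id (1 : ℝ)).sub_const 1).mul_const (ip f a)
    have := h1.fun_sub h2
    simpa using this
  have hmin : IsLocalMin (fun t : ℝ => t ^ p * A f - (t - 1) * ip f a) 1 := by
    filter_upwards [lt_mem_nhds (zero_lt_one (α := ℝ))] with t ht
    have := key t ht.le
    simp
    linarith
  have := hmin.hasDerivAt_eq_zero hd
  linarith

lemma aux_one {V : Type*} (A : (V → ℝ) → ℝ) (hA : PosOneHom A) : PosPHom 1 A := by
  intro t ht f
  rw [Real.rpow_one]
  exact hA t ht f

lemma aux_compact {V : Type*} [Fintype V] (p : ℝ) (hp : 1 ≤ p) (G : (V → ℝ) → ℝ)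
    (hcont : Continuous G) (hGnonneg : ∀ u, 0 ≤ G u)
    (hGhom : PosPHom p G) (hGzero : ∀ u, G u = 0 ↔ u = 0)
    (f : V → ℝ) (hf : f ≠ 0) : IsCompact {u | G u ≤ 1} := by
  have hs : (Metric.sphere (0 : V → ℝ) 1).Nonempty := by
    refine ⟨‖f‖⁻¹ • f, ?_⟩
    simp [norm_smul, hf]
  obtain ⟨x, hx, hmin⟩ := (isCompact_sphere (0 : V → ℝ) 1).exists_isMinOn hs hcont.continuousOn
  have hx0 : x ≠ 0 := by
    rintro rfl
    simp at hx
  have hδ : 0 < G x := lt_of_le_of_ne (hGnonneg x) (fun h => hx0 ((hGzero x).1 h.symm))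
  refine Metric.isCompact_of_isClosed_isBounded (isClosed_le hcont continuous_const) ?_
  refine (Metric.isBounded_closedBall (x := (0 : V → ℝ)) (r := max 1 (1 / G x))).subset ?_
  intro u hu
  simp only [Set.mem_ofPred_eq] at hu
  rw [mem_closedBall_zero_iff]
  by_cases h1 : ‖u‖ ≤ 1
  · exact h1.trans (le_max_left _ _)
  · push Not at h1
    refine le_trans ?_ (le_max_right _ _)
    have hu0 : ‖u‖ ≠ 0 := by positivity
    have h2 : G x ≤ G (‖u‖⁻¹ • u) := hmin (by simp [norm_smul, hu0])
    have h3 : G u = ‖u‖ ^ p * G (‖u‖⁻¹ • u) := by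
      rw [← hGhom _ (norm_nonneg u), smul_smul, mul_inv_cancel₀ hu0, one_smul]
    have h4 : ‖u‖ ≤ ‖u‖ ^ p := Real.self_le_rpow_of_one_le h1.le hp
    rw [le_div_iff₀ hδ]
    calc ‖u‖ * G x ≤ ‖u‖ ^ p * G (‖u‖⁻¹ • u) := by gcongr
      _ ≤ 1 := h3 ▸ hu

lemma aux_lower {V : Type*} (p : ℝ) (hp : 1 ≤ p) (G Φ : (V → ℝ) → ℝ)
    (hGnonneg : ∀ u, 0 ≤ G u)
    (hGhom : PosPHom p G) (hGzero : ∀ u, G u = 0 ↔ u = 0)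
    (hΦ : PosOneHom Φ) (M : ℝ) (hM : ∀ u, G u ≤ 1 → M ≤ Φ u) (u : V → ℝ) :
    ∃ t : ℝ, 0 ≤ t ∧ t ^ p = G u ∧ t * M ≤ Φ u := by
  have hp0 : p ≠ 0 := by linarith
  refine ⟨G u ^ (p⁻¹), Real.rpow_nonneg (hGnonneg u) _, Real.rpow_inv_rpow (hGnonneg u) hp0, ?_⟩
  by_cases hu : u = 0
  · have h0 : G u = 0 := (hGzero u).2 hu
    have h1 : Φ u = 0 := by
      have := hΦ 0 le_rfl u
      rw [zero_smul, zero_mul] at this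
      rw [hu]; exact this
    rw [h0, h1, Real.zero_rpow (inv_ne_zero hp0), zero_mul]
  · have hG : 0 < G u := lt_of_le_of_ne (hGnonneg u) (fun h => hu ((hGzero u).1 h.symm))
    set t := G u ^ (p⁻¹) with htdef
    have ht : 0 < t := Real.rpow_pos_of_pos hG _
    have htp : t ^ p = G u := Real.rpow_inv_rpow hG.le hp0
    have h := hM (t⁻¹ • u) (by
      rw [hGhom _ (inv_nonneg.2 ht.le), Real.inv_rpow ht.le, htp, inv_mul_cancel₀ hG.ne'])
    rw [hΦ _ (inv_nonneg.2 ht.le)] at h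
    calc t * M ≤ t * (t⁻¹ * Φ u) := by gcongr
      _ = Φ u := by field_simp

lemma aux_global {V : Type*} (p : ℝ) (hp : 1 ≤ p) (G Φ : (V → ℝ) → ℝ)
    (hGnonneg : ∀ u, 0 ≤ G u)
    (hGhom : PosPHom p G) (hGzero : ∀ u, G u = 0 ↔ u = 0)
    (hΦ : PosOneHom Φ) (c ν : ℝ) (hc : 0 ≤ c) (hν : 1 ≤ ν) (m : V → ℝ) (hGm : G m ≤ 1)
    (hM : ∀ u, G u ≤ 1 → Φ m ≤ Φ u) (hMv : Φ m = - (c * p * ν ^ (p - 1))) (u : V → ℝ) :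
    Φ (ν • m) + c * G (ν • m) ≤ Φ u + c * G u := by
  have hν0 : 0 < ν := by linarith
  obtain ⟨t, ht, htp, hle⟩ := aux_lower p hp G Φ hGnonneg hGhom hGzero hΦ (Φ m) hM u
  have h1 := mul_le_mul_of_nonneg_left (aux_rpow_tangent p ν t hp hν0 ht) hc
  rw [hΦ ν hν0.le, hGhom ν hν0.le, ← htp]
  have h2 : c * (ν ^ p * G m) ≤ c * ν ^ p := by
    have : ν ^ p * G m ≤ ν ^ p := mul_le_of_le_one_right (Real.rpow_nonneg hν0.le _) hGm
    gcongr
  rw [hMv] at hle ⊢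
  linarith

/-- (1) for `p > 1`, `c > 0`, `Φ' = Φ_f^c + c·G` attains a global minimum and
some multiple `ν ≥ 1` of every minimizer of `Φ_f^c` over `{G ≤ 1}` globally minimizes `Φ'`;
(2) if `f` itself minimizes `Φ_f^c` over `{G ≤ 1}`, then every minimizer of `Φ_f^c` over
`{G ≤ 1}` globally minimizes `Φ'`. -/
theorem Phi_prime_global_minimizers {V : Type*} [Fintype V] (p : ℝ) (hp : 1 ≤ p)
    (R1 R2 S1 S2 G : (V → ℝ) → ℝ)
    (hR1conv : ConvexOn ℝ Set.univ R1) (hR2conv : ConvexOn ℝ Set.univ R2)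
    (hS1conv : ConvexOn ℝ Set.univ S1) (hS2conv : ConvexOn ℝ Set.univ S2)
    (hR1hom : PosOneHom R1) (hR2hom : PosOneHom R2)
    (hS1hom : PosOneHom S1) (hS2hom : PosOneHom S2)
    (hRnonneg : ∀ u, 0 ≤ R1 u - R2 u) (hSnonneg : ∀ u, 0 ≤ S1 u - S2 u)
    (hGconv : ConvexOn ℝ Set.univ G) (hGnonneg : ∀ u, 0 ≤ G u)
    (hGhom : PosPHom p G) (hGzero : ∀ u, G u = 0 ↔ u = 0)
    (f : V → ℝ) (hGf : G f = 1) (hSf : S1 f - S2 f ≠ 0)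
    (c : ℝ) (hc : 0 ≤ c)
    (r2 : V → ℝ) (hr2 : r2 ∈ subdiff R2 f)
    (s1 : V → ℝ) (hs1 : s1 ∈ subdiff S1 f)
    (g : V → ℝ) (hg : g ∈ subdiff G f) :
    (1 < p → 0 < c →
      (∃ m : V → ℝ, ∀ u,
        Phi R1 R2 S1 S2 f r2 s1 g c m + c * G m ≤
          Phi R1 R2 S1 S2 f r2 s1 g c u + c * G u) ∧
      (∃ ν : ℝ, 1 ≤ ν ∧ ∀ fplus : V → ℝ, G fplus ≤ 1 →
        (∀ u, G u ≤ 1 →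
          Phi R1 R2 S1 S2 f r2 s1 g c fplus ≤ Phi R1 R2 S1 S2 f r2 s1 g c u) →
        ∀ u, Phi R1 R2 S1 S2 f r2 s1 g c (ν • fplus) + c * G (ν • fplus) ≤
          Phi R1 R2 S1 S2 f r2 s1 g c u + c * G u)) ∧
    ((∀ u, G u ≤ 1 →
        Phi R1 R2 S1 S2 f r2 s1 g c f ≤ Phi R1 R2 S1 S2 f r2 s1 g c u) →
      ∀ m : V → ℝ, G m ≤ 1 →
        (∀ u, G u ≤ 1 →
          Phi R1 R2 S1 S2 f r2 s1 g c m ≤ Phi R1 R2 S1 S2 f r2 s1 g c u) →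
        ∀ u, Phi R1 R2 S1 S2 f r2 s1 g c m + c * G m ≤
          Phi R1 R2 S1 S2 f r2 s1 g c u + c * G u) := by
  set Φ := Phi R1 R2 S1 S2 f r2 s1 g c with hΦdef
  have hΦ : PosOneHom Φ := by
    intro t ht u
    simp only [hΦdef, Phi, aux_ip_smul, hR1hom t ht, hS2hom t ht]
    ring
  have hΦf : Φ f = - (c * p) := by
    have e1 := aux_euler 1 le_rfl R2 (aux_one R2 hR2hom) f r2 hr2
    have e2 := aux_euler 1 le_rfl S1 (aux_one S1 hS1hom) f s1 hs1
    have e3 := aux_euler p hp G hGhom f g hg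
    simp only [hΦdef, Phi, e1, e2, e3, hGf]
    field_simp
    ring
  refine ⟨fun hp1 hc0 => ?_, ?_⟩
  · have hGcont : Continuous G := continuousOn_univ.1 (hGconv.continuousOn isOpen_univ)
    have hR1cont : Continuous R1 := continuousOn_univ.1 (hR1conv.continuousOn isOpen_univ)
    have hS2cont : Continuous S2 := continuousOn_univ.1 (hS2conv.continuousOn isOpen_univ)
    have hΦcont : Continuous Φ := by
      simp only [hΦdef]
      unfold Phi ip
      fun_prop
    have hf0 : f ≠ 0 := by
      intro h
      rw [(hGzero f).2 h] at hGf
      exact zero_ne_one hGf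
    obtain ⟨m, hm, hmin⟩ := (aux_compact p hp G hGcont hGnonneg hGhom hGzero f hf0).exists_isMinOn
      ⟨f, hGf.le⟩ hΦcont.continuousOn
    have hmin' : ∀ u, G u ≤ 1 → Φ m ≤ Φ u := fun u hu => hmin hu
    have hMle : Φ m ≤ - (c * p) := hΦf ▸ hmin' f hGf.le
    have hcp : 0 < c * p := by positivity
    have hq : 1 ≤ -Φ m / (c * p) := by
      rw [le_div_iff₀ hcp]; linarith
    have hpm : p - 1 ≠ 0 := by linarith
    set ν := (-Φ m / (c * p)) ^ ((p - 1)⁻¹) with hνdef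
    have hν : 1 ≤ ν := Real.one_le_rpow hq (inv_nonneg.2 (by linarith))
    have hνp : Φ m = - (c * p * ν ^ (p - 1)) := by
      rw [hνdef, Real.rpow_inv_rpow (by linarith) hpm]
      field_simp
    refine ⟨⟨ν • m, aux_global p hp G Φ hGnonneg hGhom hGzero hΦ c ν hc hν m hm hmin' hνp⟩,
      ν, hν, fun n hn hnmin => ?_⟩
    have hnm : Φ n = Φ m := le_antisymm (hnmin m hm) (hmin' n hn)
    exact aux_global p hp G Φ hGnonneg hGhom hGzero hΦ c ν hc hν n hn hnmin (hnm.trans hνp)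
  · intro hfmin m hm hmmin u
    have hmf : Φ m = Φ f := le_antisymm (hmmin f hGf.le) (hfmin m hm)
    have := aux_global p hp G Φ hGnonneg hGhom hGzero hΦ c 1 hc le_rfl m hm hmmin
      (by rw [hmf, hΦf, Real.one_rpow, mul_one]) u
    rwa [one_smul] at this
end

section
/- Let R, S : ℝ^V → ℝ be convex, positively one-homogeneous and nonnegative. Let f ∈ ℝ^V with ‖f‖₂ = 1, S(f) > 0 and R(f) > 0, and set λ := R(f)/S(f). Let c > 0 and let v be a subgradient of S at f. Then the strictly convex function Ψ(u) := R(u) + (λ/(2c))·‖u − (f + c·v)‖₂² has a unique global minimizer h over ℝ^V; moreover h ≠ 0 and h/‖h‖₂ is a minimizer over {u : ‖u‖₂ ≤ 1} of the one-homogeneous function u ↦ R(u) − λ·⟨u, v⟩ − (λ/c)·⟨u, f⟩. -/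
open Finset Filter

/-- The objective of one step of the algorithm of Bresson et al.:
`Ψ(u) = R(u) + (λ/(2c))·‖u − (f + c·v)‖₂²`. -/
noncomputable def PsiB {V : Type*} [Fintype V] (R : (V → ℝ) → ℝ) (lam c : ℝ)
    (f v : V → ℝ) (u : V → ℝ) : ℝ :=
  R u + lam / (2 * c) * ∑ i, (u i - (f i + c * v i)) ^ 2

/-- The corresponding one-homogeneous RatioDCA-prox inner objective
`Θ(u) = R(u) − λ⟨u, v⟩ − (λ/c)⟨u, f⟩`. -/
noncomputable def ThetaB {V : Type*} [Fintype V] (R : (V → ℝ) → ℝ) (lam c : ℝ)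
    (f v : V → ℝ) (u : V → ℝ) : ℝ :=
  R u - lam * ip u v - lam / c * ip u f

lemma psi_eq_theta {V : Type*} [Fintype V] (R : (V → ℝ) → ℝ) (lam c : ℝ) (hc : 0 < c)
    (f v u : V → ℝ) :
    PsiB R lam c f v u = ThetaB R lam c f v u + lam / (2 * c) * (∑ i, (u i) ^ 2)
      + lam / (2 * c) * ∑ i, (f i + c * v i) ^ 2 := by
  have e : ∑ i, (u i - (f i + c * v i)) ^ 2
      = ∑ i, (u i) ^ 2 - 2 * ip u f - 2 * c * ip u v + ∑ i, (f i + c * v i) ^ 2 := by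
    simp only [ip, Finset.mul_sum, ← Finset.sum_sub_distrib, ← Finset.sum_add_distrib]
    exact Finset.sum_congr rfl fun i _ => by ring
  unfold PsiB ThetaB
  rw [e]
  field_simp
  ring

lemma theta_smul {V : Type*} [Fintype V] (R : (V → ℝ) → ℝ) (hR : PosOneHom R) (lam c : ℝ)
    (f v u : V → ℝ) (t : ℝ) (ht : 0 ≤ t) :
    ThetaB R lam c f v (t • u) = t * ThetaB R lam c f v u := by
  have e : ∀ w : V → ℝ, ip (t • u) w = t * ip u w := by
    intro w
    simp only [ip, Finset.mul_sum, Pi.smul_apply, smul_eq_mul, mul_assoc]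
  unfold ThetaB
  rw [e, e, hR t ht]
  ring

lemma nrm_sq {V : Type*} [Fintype V] (u : V → ℝ) : nrm u ^ 2 = ∑ i, (u i) ^ 2 :=
  Real.sq_sqrt (Finset.sum_nonneg fun i _ => sq_nonneg _)

lemma nrm_nonneg {V : Type*} [Fintype V] (u : V → ℝ) : 0 ≤ nrm u := Real.sqrt_nonneg _

lemma sumsq_smul {V : Type*} [Fintype V] (t : ℝ) (u : V → ℝ) :
    ∑ i, ((t • u) i) ^ 2 = t ^ 2 * ∑ i, (u i) ^ 2 := by
  simp only [Finset.mul_sum, Pi.smul_apply, smul_eq_mul, mul_pow]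

lemma psi_exists {V : Type*} [Fintype V] (R : (V → ℝ) → ℝ)
    (hRconv : ConvexOn ℝ Set.univ R) (hRnonneg : ∀ u, 0 ≤ R u) (k : ℝ) (hk : 0 < k)
    (a : V → ℝ) :
    ∃ h : V → ℝ, ∀ u, R h + k * ∑ i, (h i - a i) ^ 2 ≤ R u + k * ∑ i, (u i - a i) ^ 2 := by
  have hcR : Continuous R := by
    rw [← continuousOn_univ]
    exact hRconv.continuousOn isOpen_univ
  have hcont : Continuous fun u : V → ℝ => R u + k * ∑ i, (u i - a i) ^ 2 := by fun_prop
  refine hcont.exists_forall_le ?_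
  have h1 : Tendsto (fun u : V → ℝ => k * (dist u a) ^ 2) (cocompact _) atTop :=
    ((tendsto_pow_atTop two_ne_zero).comp
      (tendsto_dist_right_cocompact_atTop a)).const_mul_atTop hk
  refine tendsto_atTop_mono (fun u => ?_) h1
  have h2 : dist u a ^ 2 ≤ ∑ i, (u i - a i) ^ 2 := by
    have h3 : dist u a ≤ Real.sqrt (∑ i, (u i - a i) ^ 2) := by
      rw [dist_pi_le_iff (Real.sqrt_nonneg _)]
      intro i
      rw [Real.dist_eq]
      apply Real.abs_le_sqrt
      exact Finset.single_le_sum (f := fun i => (u i - a i) ^ 2)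
        (fun i _ => sq_nonneg _) (Finset.mem_univ i)
    calc dist u a ^ 2 ≤ (Real.sqrt (∑ i, (u i - a i) ^ 2)) ^ 2 := by gcongr
      _ = _ := Real.sq_sqrt (Finset.sum_nonneg fun i _ => sq_nonneg _)
  have := hRnonneg u
  nlinarith

/-- the strictly convex function `Ψ` has a unique global minimizer `h`;
moreover `h ≠ 0` and `h/‖h‖₂` minimizes `Θ` over the unit ball. -/
theorem bresson_step_equals_ratioDCA_prox_step {V : Type*} [Fintype V]
    (R S : (V → ℝ) → ℝ)
    (hRconv : ConvexOn ℝ Set.univ R) (hSconv : ConvexOn ℝ Set.univ S)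
    (hRhom : PosOneHom R) (hShom : PosOneHom S)
    (hRnonneg : ∀ u, 0 ≤ R u) (hSnonneg : ∀ u, 0 ≤ S u)
    (f : V → ℝ) (hf : nrm f = 1) (hSf : 0 < S f) (hRf : 0 < R f)
    (c : ℝ) (hc : 0 < c)
    (v : V → ℝ) (hv : v ∈ subdiff S f) :
    ∃ h : V → ℝ,
      (∀ u, PsiB R (R f / S f) c f v h ≤ PsiB R (R f / S f) c f v u) ∧
      (∀ h' : V → ℝ, (∀ u, PsiB R (R f / S f) c f v h' ≤ PsiB R (R f / S f) c f v u) →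
        h' = h) ∧
      h ≠ 0 ∧
      nrm ((nrm h)⁻¹ • h) ≤ 1 ∧
      (∀ u, nrm u ≤ 1 →
        ThetaB R (R f / S f) c f v ((nrm h)⁻¹ • h) ≤ ThetaB R (R f / S f) c f v u) := by
  set lam := R f / S f with hlam
  have hlp : 0 < lam := div_pos hRf hSf
  have hk : 0 < lam / (2 * c) := by positivity
  obtain ⟨h, hh⟩ := psi_exists R hRconv hRnonneg _ hk (fun i => f i + c * v i)
  have hmin : ∀ u, PsiB R lam c f v h ≤ PsiB R lam c f v u := hh
  have hR0 : R 0 = 0 := by simpa using hRhom 0 le_rfl 0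
  have hS0 : S 0 = 0 := by simpa using hShom 0 le_rfl 0
  have hne : h ≠ 0 := by
    rintro rfl
    have h1 := hmin f
    rw [psi_eq_theta _ _ _ hc, psi_eq_theta _ _ _ hc, ← nrm_sq f, hf] at h1
    have hv0 := hv 0
    have e : ip v (0 - f) = - ip f v := by
      simp [ip, mul_comm]
    rw [e, hS0] at hv0
    have hff : ip f f = 1 := by
      have := nrm_sq f
      rw [hf] at this
      simp only [ip, ← pow_two]
      linarith
    have hT0 : ThetaB R lam c f v 0 = 0 := by simp [ThetaB, ip, hR0]
    rw [hT0] at h1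
    simp only [ThetaB, hff, Pi.zero_apply] at h1
    have h3 : lam * S f = R f := by rw [hlam]; field_simp
    have h4 : lam * S f ≤ lam * ip f v := by
      apply mul_le_mul_of_nonneg_left _ hlp.le
      linarith
    have h5 : lam / c = 2 * (lam / (2 * c)) := by field_simp
    rw [h5] at h1
    simp at h1
    linarith
  have hnpos : 0 < nrm h := by
    apply Real.sqrt_pos.2
    obtain ⟨i, hi⟩ := Function.ne_iff.1 hne
    exact Finset.sum_pos' (fun i _ => sq_nonneg _) ⟨i, Finset.mem_univ i, by
      have : h i ≠ 0 := hi
      positivity⟩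
  refine ⟨h, hmin, ?_, hne, ?_, ?_⟩
  · intro h' hmin'
    have h1 := hmin' h
    have h2 := hmin ((1 / 2 : ℝ) • h + (1 / 2 : ℝ) • h')
    have h3 := hRconv.2 (Set.mem_univ h) (Set.mem_univ h')
      (show (0 : ℝ) ≤ 1 / 2 by norm_num) (show (0 : ℝ) ≤ 1 / 2 by norm_num) (by norm_num)
    have e : ∑ i, (((1 / 2 : ℝ) • h + (1 / 2 : ℝ) • h') i - (f i + c * v i)) ^ 2
        = 1 / 2 * ∑ i, (h i - (f i + c * v i)) ^ 2 + 1 / 2 * ∑ i, (h' i - (f i + c * v i)) ^ 2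
          - 1 / 4 * ∑ i, (h' i - h i) ^ 2 := by
      simp only [Finset.mul_sum, ← Finset.sum_sub_distrib, ← Finset.sum_add_distrib]
      refine Finset.sum_congr rfl fun i _ => ?_
      simp only [Pi.add_apply, Pi.smul_apply, smul_eq_mul]
      ring
    unfold PsiB at h1 h2
    rw [e] at h2
    simp only [smul_eq_mul] at h3
    have h4 : lam / (2 * c) * ∑ i, (h' i - h i) ^ 2 ≤ 0 := by linarith
    have h5 : ∑ i, (h' i - h i) ^ 2 ≤ 0 := nonpos_of_mul_nonpos_right h4 hk
    have h6 := (Finset.sum_eq_zero_iff_of_nonneg (fun i _ => sq_nonneg (h' i - h i))).1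
      (le_antisymm h5 (Finset.sum_nonneg fun i _ => sq_nonneg _))
    funext i
    have := h6 i (Finset.mem_univ i)
    exact sub_eq_zero.1 (pow_eq_zero_iff two_ne_zero |>.1 this)
  · have h1 := nrm_sq ((nrm h)⁻¹ • h)
    rw [sumsq_smul, ← nrm_sq h, ← mul_pow, inv_mul_cancel₀ hnpos.ne'] at h1
    nlinarith [nrm_nonneg ((nrm h)⁻¹ • h)]
  · intro u hu
    have h1 := hmin (nrm h • u)
    rw [psi_eq_theta _ _ _ hc, psi_eq_theta _ _ _ hc, sumsq_smul, ← nrm_sq h, ← nrm_sq u,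
      theta_smul R hRhom _ _ _ _ _ _ hnpos.le] at h1
    rw [theta_smul R hRhom _ _ _ _ _ _ (inv_nonneg.2 hnpos.le), inv_mul_le_iff₀ hnpos]
    have h2 : nrm u ^ 2 ≤ 1 := by nlinarith [nrm_nonneg u]
    have h3 : nrm h ^ 2 * nrm u ^ 2 ≤ nrm h ^ 2 := by nlinarith [sq_nonneg (nrm h)]
    have h4 := mul_le_mul_of_nonneg_left h3 hk.le
    linarith
end

section
/- Let f ∈ ℝ^V with G(f) = 1 and S(f) ≠ 0, let c ≥ 0, and fix subgradients r₂ ∈ ∂R₂(f), s₁ ∈ ∂S₁(f), g ∈ ∂G(f). If f⁺ ∈ ℝ^V satisfies G(f⁺) ≤ 1 and Φ_f^c(f⁺) < Φ_f^c(f), then S(f⁺) > 0 and F(f⁺) < F(f). -/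
open Finset Filter

/-- one descent step of RatioDCA-prox: if `G f⁺ ≤ 1` and
`Φ_f^c(f⁺) < Φ_f^c(f)`, then `S(f⁺) > 0` and `F(f⁺) < F(f)`. -/
theorem ratioDCA_prox_single_step_descent {V : Type*} [Fintype V] (p : ℝ) (hp : 1 ≤ p)
    (R1 R2 S1 S2 G : (V → ℝ) → ℝ)
    (hR1conv : ConvexOn ℝ Set.univ R1) (hR2conv : ConvexOn ℝ Set.univ R2)
    (hS1conv : ConvexOn ℝ Set.univ S1) (hS2conv : ConvexOn ℝ Set.univ S2)
    (hR1hom : PosOneHom R1) (hR2hom : PosOneHom R2)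
    (hS1hom : PosOneHom S1) (hS2hom : PosOneHom S2)
    (hRnonneg : ∀ u, 0 ≤ R1 u - R2 u) (hSnonneg : ∀ u, 0 ≤ S1 u - S2 u)
    (hGconv : ConvexOn ℝ Set.univ G) (hGnonneg : ∀ u, 0 ≤ G u)
    (hGhom : PosPHom p G) (hGzero : ∀ u, G u = 0 ↔ u = 0)
    (f : V → ℝ) (hGf : G f = 1) (hSf : S1 f - S2 f ≠ 0)
    (c : ℝ) (hc : 0 ≤ c)
    (r2 : V → ℝ) (hr2 : r2 ∈ subdiff R2 f)
    (s1 : V → ℝ) (hs1 : s1 ∈ subdiff S1 f)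
    (g : V → ℝ) (hg : g ∈ subdiff G f)
    (fplus : V → ℝ) (hmem : G fplus ≤ 1)
    (hdec : Phi R1 R2 S1 S2 f r2 s1 g c fplus < Phi R1 R2 S1 S2 f r2 s1 g c f) :
    0 < S1 fplus - S2 fplus ∧
      (R1 fplus - R2 fplus) / (S1 fplus - S2 fplus) <
        (R1 f - R2 f) / (S1 f - S2 f) := by
  have key : ∀ a u : V → ℝ, ip a (u - f) = ip u a - ip f a := by
    intro a u
    simp only [ip, ← Finset.sum_sub_distrib]
    refine Finset.sum_congr rfl fun i _ => ?_
    simp only [Pi.sub_apply]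
    ring
  have h1 := hr2 fplus
  have h2 := hs1 fplus
  have h3 := hg fplus
  rw [key] at h1 h2 h3
  unfold Phi at hdec
  have hS : 0 < S1 f - S2 f := lt_of_le_of_ne (hSnonneg f) (Ne.symm hSf)
  have hl : 0 ≤ (R1 f - R2 f) / (S1 f - S2 f) := div_nonneg (hRnonneg f) hS.le
  have hlS : (R1 f - R2 f) / (S1 f - S2 f) * (S1 f - S2 f) = R1 f - R2 f :=
    div_mul_cancel₀ _ hSf
  generalize (R1 f - R2 f) / (S1 f - S2 f) = l at *
  have h4 := mul_le_mul_of_nonneg_left h2 hl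
  have h5 : c * (ip fplus g - ip f g) ≤ 0 :=
    mul_nonpos_of_nonneg_of_nonpos hc (by linarith)
  have hlt : R1 fplus - R2 fplus < l * (S1 fplus - S2 fplus) := by
    linarith
  have hpos : 0 < S1 fplus - S2 fplus :=
    pos_of_mul_pos_right (lt_of_le_of_lt (hRnonneg fplus) hlt) hl
  exact ⟨hpos, (div_lt_iff₀ hpos).2 hlt⟩
end

section
/- Let (f^k)_{k≥0} be a sequence in ℝ^V with G(f^k) = 1 and S(f^k) ≠ 0 for all k, and let (c^k) be a sequence of nonnegative reals. Suppose for each k there are subgradients r₂^k ∈ ∂R₂(f^k), s₁^k ∈ ∂S₁(f^k), g^k ∈ ∂G(f^k) such that f^{k+1} minimizes Φ_{f^k}^{c^k} over {u : G(u) ≤ 1} and Φ_{f^k}^{c^k}(f^{k+1}) < Φ_{f^k}^{c^k}(f^k). Then F(f^{k+1}) < F(f^k) for all k ≥ 0, and c^k·⟨f^{k+1} − f^k, g^k⟩ → 0 as k → ∞. -/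
open Finset Filter

lemma ip_comm' {V : Type*} [Fintype V] (a b : V → ℝ) : ip a b = ip b a := by
  unfold ip; exact Finset.sum_congr rfl fun i _ => mul_comm _ _

lemma ip_sub_right {V : Type*} [Fintype V] (a b d : V → ℝ) :
    ip a (b - d) = ip a b - ip a d := by
  unfold ip; rw [← Finset.sum_sub_distrib]
  exact Finset.sum_congr rfl fun i _ => by simp only [Pi.sub_apply]; ring

lemma ip_self_of_hom {V : Type*} [Fintype V] {A : (V → ℝ) → ℝ} (hA : PosOneHom A)
    {f a : V → ℝ} (ha : a ∈ subdiff A f) : ip f a = A f := by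
  have h0 := ha ((0 : ℝ) • f)
  have h2 := ha ((2 : ℝ) • f)
  rw [hA _ (by norm_num), ip_sub_right] at h0 h2
  have e0 : ip a ((0 : ℝ) • f) = 0 := by simp [ip]
  have e2 : ip a ((2 : ℝ) • f) = 2 * ip a f := by
    unfold ip; rw [Finset.mul_sum]
    exact Finset.sum_congr rfl fun i _ => by simp only [Pi.smul_apply, smul_eq_mul]; ring
  rw [e0] at h0
  rw [e2] at h2
  rw [ip_comm']
  linarith

lemma ip_le_of_hom {V : Type*} [Fintype V] {A : (V → ℝ) → ℝ} (hA : PosOneHom A)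
    {f a : V → ℝ} (ha : a ∈ subdiff A f) (u : V → ℝ) : ip u a ≤ A u := by
  have h := ha u
  have h1 := ip_self_of_hom hA ha
  rw [ip_sub_right, ip_comm' a u, ip_comm' a f] at h
  linarith

lemma convex_cont {V : Type*} [Fintype V] {A : (V → ℝ) → ℝ} (h : ConvexOn ℝ Set.univ A) :
    Continuous A := by
  rw [← continuousOn_univ]
  exact h.continuousOn isOpen_univ

lemma level_bounded {V : Type*} [Fintype V] {p : ℝ} (hp : 1 ≤ p) {G : (V → ℝ) → ℝ}
    (hG : ConvexOn ℝ Set.univ G) (hGnonneg : ∀ u, 0 ≤ G u)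
    (hGhom : PosPHom p G) (hGzero : ∀ u, G u = 0 ↔ u = 0) :
    ∃ K : ℝ, ∀ u, G u = 1 → ‖u‖ ≤ K := by
  rcases (Metric.sphere (0 : V → ℝ) 1).eq_empty_or_nonempty with he | hne
  · refine ⟨0, fun u hu => ?_⟩
    by_contra! hn
    have : (‖u‖⁻¹ • u) ∈ Metric.sphere (0 : V → ℝ) 1 := by
      simp [norm_smul, hn.ne']
    rw [he] at this
    exact this
  · obtain ⟨x, hx, hmin⟩ := (isCompact_sphere (0 : V → ℝ) 1).exists_isMinOn hne
      (convex_cont hG).continuousOn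
    have hx0 : x ≠ 0 := by
      rintro rfl
      simp at hx
    have hm : 0 < G x := lt_of_le_of_ne (hGnonneg x) fun h => hx0 ((hGzero x).1 h.symm)
    refine ⟨max 1 (1 / G x), fun u hu => ?_⟩
    by_cases h1 : ‖u‖ ≤ 1
    · exact h1.trans (le_max_left _ _)
    · push Not at h1
      refine le_trans ?_ (le_max_right _ _)
      have hn : 0 < ‖u‖ := by linarith
      have hmem : (‖u‖⁻¹ • u) ∈ Metric.sphere (0 : V → ℝ) 1 := by
        simp [norm_smul, hn.ne']
      have h2 : G x ≤ G (‖u‖⁻¹ • u) := hmin hmem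
      have h3 := hGhom ‖u‖ hn.le (‖u‖⁻¹ • u)
      rw [smul_smul, mul_inv_cancel₀ hn.ne', one_smul, hu] at h3
      have h4 : ‖u‖ ≤ ‖u‖ ^ p := by
        simpa using Real.rpow_le_rpow_of_exponent_le h1.le hp
      rw [le_div_iff₀ hm, h3]
      exact mul_le_mul h4 h2 hm.le (by linarith)

/-- Proposition on monotone descent: along the RatioDCA-prox iterates,
`F(f^{k+1}) < F(f^k)` for all `k`, and `c^k⟨f^{k+1} − f^k, g^k⟩ → 0`. -/
theorem ratioDCA_prox_monotone_and_convergence {V : Type*} [Fintype V] (p : ℝ) (hp : 1 ≤ p)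
    (R1 R2 S1 S2 G : (V → ℝ) → ℝ)
    (hR1conv : ConvexOn ℝ Set.univ R1) (hR2conv : ConvexOn ℝ Set.univ R2)
    (hS1conv : ConvexOn ℝ Set.univ S1) (hS2conv : ConvexOn ℝ Set.univ S2)
    (hR1hom : PosOneHom R1) (hR2hom : PosOneHom R2)
    (hS1hom : PosOneHom S1) (hS2hom : PosOneHom S2)
    (hRnonneg : ∀ u, 0 ≤ R1 u - R2 u) (hSnonneg : ∀ u, 0 ≤ S1 u - S2 u)
    (hGconv : ConvexOn ℝ Set.univ G) (hGnonneg : ∀ u, 0 ≤ G u)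
    (hGhom : PosPHom p G) (hGzero : ∀ u, G u = 0 ↔ u = 0)
    (f : ℕ → V → ℝ) (c : ℕ → ℝ) (hc : ∀ k, 0 ≤ c k)
    (hGf : ∀ k, G (f k) = 1) (hSf : ∀ k, S1 (f k) - S2 (f k) ≠ 0)
    (r2 s1 g : ℕ → V → ℝ)
    (hr2 : ∀ k, r2 k ∈ subdiff R2 (f k))
    (hs1 : ∀ k, s1 k ∈ subdiff S1 (f k))
    (hg : ∀ k, g k ∈ subdiff G (f k))
    (hmin : ∀ k, ∀ u, G u ≤ 1 →
      Phi R1 R2 S1 S2 (f k) (r2 k) (s1 k) (g k) (c k) (f (k + 1)) ≤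
        Phi R1 R2 S1 S2 (f k) (r2 k) (s1 k) (g k) (c k) u)
    (hdec : ∀ k,
      Phi R1 R2 S1 S2 (f k) (r2 k) (s1 k) (g k) (c k) (f (k + 1)) <
        Phi R1 R2 S1 S2 (f k) (r2 k) (s1 k) (g k) (c k) (f k)) :
    (∀ k, (R1 (f (k + 1)) - R2 (f (k + 1))) / (S1 (f (k + 1)) - S2 (f (k + 1))) <
        (R1 (f k) - R2 (f k)) / (S1 (f k) - S2 (f k))) ∧
    Tendsto (fun k => c k * ip (f (k + 1) - f k) (g k)) atTop (nhds 0) := by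
  have hd : ∀ k, c k * ip (f (k + 1) - f k) (g k) ≤ 0 := by
    intro k
    have h := hg k (f (k + 1))
    rw [hGf, hGf, ip_comm'] at h
    exact mul_nonpos_of_nonneg_of_nonpos (hc k) (by linarith)
  have hS : ∀ k, 0 < S1 (f k) - S2 (f k) := fun k =>
    lt_of_le_of_ne (hSnonneg _) (hSf k).symm
  obtain ⟨F, hF⟩ : ∃ F : ℕ → ℝ, ∀ k, F k = (R1 (f k) - R2 (f k)) / (S1 (f k) - S2 (f k)) :=
    ⟨_, fun _ => rfl⟩
  have hFR : ∀ k, F k * (S1 (f k) - S2 (f k)) = R1 (f k) - R2 (f k) := fun k => by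
    rw [hF, div_mul_cancel₀ _ (hSf k)]
  have hF0 : ∀ k, 0 ≤ F k := fun k => by
    rw [hF]; exact div_nonneg (hRnonneg _) (hSnonneg _)
  have key : ∀ k, (F (k + 1) - F k) * (S1 (f (k + 1)) - S2 (f (k + 1))) <
      c k * ip (f (k + 1) - f k) (g k) := by
    intro k
    have h := hdec k
    unfold Phi at h
    rw [← hF, ip_self_of_hom hR2hom (hr2 k), ip_self_of_hom hS1hom (hs1 k)] at h
    have a1 := ip_le_of_hom hR2hom (hr2 k) (f (k + 1))
    have a2 := mul_le_mul_of_nonneg_left (ip_le_of_hom hS1hom (hs1 k) (f (k + 1))) (hF0 k)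
    have a3 := hFR k
    have a4 := hFR (k + 1)
    rw [ip_comm', ip_sub_right, ip_comm' (g k), ip_comm' (g k)]
    linarith
  have hlt : ∀ k, F (k + 1) < F k := by
    intro k
    by_contra! hcon
    have := mul_nonneg (sub_nonneg.2 hcon) (hS (k + 1)).le
    linarith [key k, hd k]
  refine ⟨fun k => by rw [← hF, ← hF]; exact hlt k, ?_⟩
  obtain ⟨K, hK⟩ := level_bounded hp hGconv hGnonneg hGhom hGzero
  obtain ⟨M, hM⟩ := (isCompact_closedBall (0 : V → ℝ) K).exists_bound_of_continuousOn
    ((convex_cont hS1conv).sub (convex_cont hS2conv)).continuousOn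
  have hM' : ∀ k, S1 (f k) - S2 (f k) ≤ M := fun k =>
    (le_abs_self _).trans (hM (f k) (by simpa using hK _ (hGf k)))
  have hconv := tendsto_atTop_ciInf (antitone_nat_of_succ_le fun k => (hlt k).le)
    ⟨0, by rintro _ ⟨k, rfl⟩; exact hF0 k⟩
  have hdiff := ((hconv.comp (tendsto_add_atTop_nat 1)).sub hconv).mul_const M
  rw [sub_self, zero_mul] at hdiff
  refine tendsto_of_tendsto_of_tendsto_of_le_of_le hdiff tendsto_const_nhds (fun k => ?_) hd
  have h1 := mul_le_mul_of_nonpos_left (hM' (k + 1)) (sub_nonpos.2 (hlt k).le)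
  exact h1.trans (key k).le
end

section
/- Let f₂ ∈ ℝ^V with ‖f₂‖₂ = 1 and S(f₂) ≠ 0, and set f₁ := f₂ / G(f₂)^{1/p}. Fix subgradients r₂ ∈ ∂R₂(f₂) = ∂R₂(f₁) and s₁ ∈ ∂S₁(f₂) = ∂S₁(f₁) (these subdifferentials coincide by positive one-homogeneity), let c ≥ 0 and g ∈ ∂G(f₁). If f₂ minimizes the function u ↦ R₁(u) − ⟨u, r₂⟩ + F(f₂)·(S₂(u) − ⟨u, s₁⟩) over {u : ‖u‖₂ ≤ 1}, then f₁ minimizes Φ_{f₁}^c over {u : G(u) ≤ 1}. -/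
open Finset Filter

theorem ip_smul_left_aux {V : Type*} [Fintype V] (t : ℝ) (f g : V → ℝ) :
    ip (t • f) g = t * ip f g := by
  simp [ip, Finset.mul_sum, mul_assoc]

theorem ip_comm_aux {V : Type*} [Fintype V] (f g : V → ℝ) : ip f g = ip g f := by
  simp [ip, mul_comm]

theorem ip_sub_aux {V : Type*} [Fintype V] (a f g : V → ℝ) :
    ip a (f - g) = ip a f - ip a g := by
  simp [ip, mul_sub]

theorem nrm_smul_aux {V : Type*} [Fintype V] (t : ℝ) (ht : 0 ≤ t) (f : V → ℝ) :
    nrm (t • f) = t * nrm f := by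
  have h : ∑ i, ((t • f) i) ^ 2 = t ^ 2 * ∑ i, (f i) ^ 2 := by
    simp [Finset.mul_sum, mul_pow]
  rw [nrm, nrm, h, Real.sqrt_mul (sq_nonneg t), Real.sqrt_sq ht]

theorem euler_aux {V : Type*} [Fintype V] (A : (V → ℝ) → ℝ) (hA : PosOneHom A)
    (f a : V → ℝ) (ha : a ∈ subdiff A f) : ip f a = A f := by
  have h0 := ha ((0 : ℝ) • f)
  have h2 := ha ((2 : ℝ) • f)
  rw [hA _ (by norm_num), ip_sub_aux, ip_comm_aux a, ip_smul_left_aux, ip_comm_aux a] at h0 h2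
  linarith

/-- if `f₂` (with `‖f₂‖₂ = 1`) minimizes the RatioDCA inner problem over the
Euclidean unit ball, then `f₁ = f₂ / G(f₂)^{1/p}` minimizes `Φ_{f₁}^c` over `{u : G u ≤ 1}`. -/
theorem ratioDCA_termination_implies_prox_termination {V : Type*} [Fintype V]
    (p : ℝ) (hp : 1 ≤ p)
    (R1 R2 S1 S2 G : (V → ℝ) → ℝ)
    (hR1conv : ConvexOn ℝ Set.univ R1) (hR2conv : ConvexOn ℝ Set.univ R2)
    (hS1conv : ConvexOn ℝ Set.univ S1) (hS2conv : ConvexOn ℝ Set.univ S2)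
    (hR1hom : PosOneHom R1) (hR2hom : PosOneHom R2)
    (hS1hom : PosOneHom S1) (hS2hom : PosOneHom S2)
    (hRnonneg : ∀ u, 0 ≤ R1 u - R2 u) (hSnonneg : ∀ u, 0 ≤ S1 u - S2 u)
    (hGconv : ConvexOn ℝ Set.univ G) (hGnonneg : ∀ u, 0 ≤ G u)
    (hGhom : PosPHom p G) (hGzero : ∀ u, G u = 0 ↔ u = 0)
    (f2 : V → ℝ) (hf2 : nrm f2 = 1) (hSf2 : S1 f2 - S2 f2 ≠ 0)
    (f1 : V → ℝ) (hf1 : f1 = (G f2 ^ ((1 : ℝ) / p))⁻¹ • f2)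
    (c : ℝ) (hc : 0 ≤ c)
    (r2 : V → ℝ) (hr2 : r2 ∈ subdiff R2 f2) (hr2' : r2 ∈ subdiff R2 f1)
    (s1 : V → ℝ) (hs1 : s1 ∈ subdiff S1 f2) (hs1' : s1 ∈ subdiff S1 f1)
    (g : V → ℝ) (hg : g ∈ subdiff G f1)
    (hmin2 : ∀ u, nrm u ≤ 1 →
      Phi R1 R2 S1 S2 f2 r2 s1 g 0 f2 ≤ Phi R1 R2 S1 S2 f2 r2 s1 g 0 u) :
    G f1 ≤ 1 ∧
      ∀ u, G u ≤ 1 →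
        Phi R1 R2 S1 S2 f1 r2 s1 g c f1 ≤ Phi R1 R2 S1 S2 f1 r2 s1 g c u := by
  have hG2 : 0 < G f2 := by
    refine lt_of_le_of_ne (hGnonneg _) (fun h => ?_)
    have h0 := (hGzero f2).1 h.symm
    rw [h0] at hf2
    simp [nrm] at hf2
  have hp0 : p ≠ 0 := by linarith
  have hb : 0 < G f2 ^ ((1 : ℝ) / p) := Real.rpow_pos_of_pos hG2 _
  have hbp : (G f2 ^ ((1 : ℝ) / p)) ^ p = G f2 := by
    rw [← Real.rpow_mul hG2.le, one_div, inv_mul_cancel₀ hp0, Real.rpow_one]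
  have ha : 0 < (G f2 ^ ((1 : ℝ) / p))⁻¹ := inv_pos.2 hb
  have hG1 : G f1 = 1 := by
    rw [hf1, hGhom _ ha.le, Real.inv_rpow hb.le, hbp, inv_mul_cancel₀ hG2.ne']
  generalize (G f2 ^ ((1 : ℝ) / p))⁻¹ = a at hf1 ha
  have hF : (R1 f1 - R2 f1) / (S1 f1 - S2 f1) = (R1 f2 - R2 f2) / (S1 f2 - S2 f2) := by
    rw [hf1, hR1hom _ ha.le, hR2hom _ ha.le, hS1hom _ ha.le, hS2hom _ ha.le, ← mul_sub, ← mul_sub,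
      mul_div_mul_left _ _ ha.ne']
  have hzero : ∀ u, ip u r2 = R2 u → ip u s1 = S1 u →
      (R1 u - R2 u) / (S1 u - S2 u) = (R1 f2 - R2 f2) / (S1 f2 - S2 f2) →
      S1 u - S2 u ≠ 0 →
      R1 u - ip u r2 + ((R1 f2 - R2 f2) / (S1 f2 - S2 f2)) * (S2 u - ip u s1) = 0 := by
    intro u h1 h2 h3 h4
    rw [h1, h2, ← h3]
    have := div_mul_cancel₀ (R1 u - R2 u) h4
    linarith
  have hS1 : S1 f1 - S2 f1 ≠ 0 := by
    rw [hf1, hS1hom _ ha.le, hS2hom _ ha.le, ← mul_sub]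
    exact mul_ne_zero ha.ne' hSf2
  have z2 := hzero f2 (euler_aux R2 hR2hom _ _ hr2) (euler_aux S1 hS1hom _ _ hs1) rfl hSf2
  have z1 := hzero f1 (euler_aux R2 hR2hom _ _ hr2') (euler_aux S1 hS1hom _ _ hs1') hF hS1
  refine ⟨hG1.le, fun u hu => ?_⟩
  have hn : 0 ≤ nrm u := Real.sqrt_nonneg _
  have ht : 0 < (1 + nrm u)⁻¹ := by positivity
  have hm := hmin2 ((1 + nrm u)⁻¹ • u) (by
    rw [nrm_smul_aux _ ht.le, inv_mul_le_iff₀ (by positivity)]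
    linarith)
  have hgu := hg u
  rw [ip_sub_aux, ip_comm_aux g, ip_comm_aux g] at hgu
  have hgu2 : 0 ≤ c * (ip f1 g - ip u g) := mul_nonneg hc (by linarith)
  simp only [Phi] at hm ⊢
  rw [hF]
  rw [z2, hR1hom _ ht.le, hS2hom _ ht.le, ip_smul_left_aux, ip_smul_left_aux] at hm
  have hpos : 0 ≤ R1 u - ip u r2 +
      ((R1 f2 - R2 f2) / (S1 f2 - S2 f2)) * (S2 u - ip u s1) := by
    refine nonneg_of_mul_nonneg_right (a := (1 + nrm u)⁻¹) ?_ ht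
    linarith
  rw [z1]
  linarith
end

section
/- Let Ŝ : 2^V → ℝ be a submodular set function with Ŝ(∅) = Ŝ(V) = 0 and let S be its Lovasz extension (which is convex). Then for every f ∈ ℝ^V, every subgradient s of S at f, and every i ∈ V, ⟨s, 1_{C_i}⟩ = S(1_{C_i}) = Ŝ(C_i), where C_i := {j ∈ V : f_j > f_i}. -/
open Finset Filter

lemma tele_aux (G : ℕ → ℝ) (m N : ℕ) :
    ∑ k ∈ Finset.range N, (if m ≤ k then G k - G (k+1) else 0) =
      if m ≤ N then G m - G N else 0 := by
  induction N with
  | zero =>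
    by_cases h : m ≤ 0
    · have : m = 0 := by omega
      subst this; simp
    · simp [h]
  | succ N ih =>
    rw [Finset.sum_range_succ, ih]
    by_cases h : m ≤ N
    · have h' : m ≤ N + 1 := by omega
      simp [h, h']
    · by_cases h' : m ≤ N + 1
      · have : m = N + 1 := by omega
        subst this; simp
      · simp [h, h']

lemma tele {n : ℕ} (Shat : Finset (Fin n) → ℝ) (hempty : Shat ∅ = 0)
    (σ : Equiv.Perm (Fin n)) (C : Finset (Fin n))
    (hC : ∀ k l : Fin n, k ≤ l → σ k ∈ C → σ l ∈ C) :
    ∑ k : Fin n, indic C (σ k) *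
    (Shat (Finset.univ.filter fun j => (k : ℕ) ≤ (σ.symm j : ℕ)) -
     Shat (Finset.univ.filter fun j => (k : ℕ) + 1 ≤ (σ.symm j : ℕ))) = Shat C := by
  classical
  obtain ⟨m, hmn, hm⟩ : ∃ m : ℕ, m ≤ n ∧ ∀ k : Fin n, σ k ∈ C ↔ m ≤ (k : ℕ) := by
    have hex : ∃ m : ℕ, n ≤ m ∨ ∃ k : Fin n, (k : ℕ) = m ∧ σ k ∈ C := ⟨n, Or.inl le_rfl⟩
    refine ⟨Nat.find hex, Nat.find_min' hex (Or.inl le_rfl), fun k => ⟨fun h => ?_, fun h => ?_⟩⟩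
    · exact Nat.find_min' hex (Or.inr ⟨k, rfl, h⟩)
    · rcases Nat.find_spec hex with h1 | ⟨l, hl, hlC⟩
      · have := k.isLt
        omega
      · refine hC l k ?_ hlC
        rw [Fin.le_def]; omega
  have h1 : ∀ k : Fin n, indic C (σ k) *
    (Shat (Finset.univ.filter fun j => (k : ℕ) ≤ (σ.symm j : ℕ)) -
     Shat (Finset.univ.filter fun j => (k : ℕ) + 1 ≤ (σ.symm j : ℕ))) =
     (fun k : ℕ => if m ≤ k then
      (fun a : ℕ => Shat (Finset.univ.filter fun j => a ≤ (σ.symm j : ℕ))) k -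
      (fun a : ℕ => Shat (Finset.univ.filter fun j => a ≤ (σ.symm j : ℕ))) (k+1) else 0) (k : ℕ) := by
    intro k
    by_cases h : m ≤ (k : ℕ)
    · simp [indic, hm, h]
    · simp [indic, hm, h]
  rw [Finset.sum_congr rfl (fun k _ => h1 k)]
  refine (Fin.sum_univ_eq_sum_range (fun k : ℕ => if m ≤ k then
      (fun a : ℕ => Shat (Finset.univ.filter fun j => a ≤ (σ.symm j : ℕ))) k -
      (fun a : ℕ => Shat (Finset.univ.filter fun j => a ≤ (σ.symm j : ℕ))) (k+1) else 0) n).trans ?_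
  refine (tele_aux (fun a : ℕ => Shat (Finset.univ.filter fun j => a ≤ (σ.symm j : ℕ))) m n).trans ?_
  rw [if_pos hmn]
  have e1 : (Finset.univ.filter fun j => m ≤ (σ.symm j : ℕ)) = C := by
    ext j
    have := hm (σ.symm j)
    simp at this
    simp [this]
  have e2 : (Finset.univ.filter fun j => n ≤ (σ.symm j : ℕ)) = ∅ := by
    ext j
    simp
  simp only [e1, e2, hempty, sub_zero]

lemma sort_congr {n : ℕ} (f g : Fin n → ℝ) (h : ∀ j k, f j < f k ↔ g j < g k) :
    Tuple.sort g = Tuple.sort f := by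
  symm
  rw [Tuple.eq_sort_iff]
  have hm := Tuple.eq_sort_iff.1 (rfl : Tuple.sort f = Tuple.sort f)
  refine ⟨fun a b hab => ?_, fun a b hab he => hm.2 a b hab ?_⟩
  · have := hm.1 hab
    simp only [Function.comp] at this ⊢
    rw [← not_lt] at this ⊢
    rwa [← h]
  · refine le_antisymm ?_ ?_ <;> rw [← not_lt, h, he] <;> exact lt_irrefl _

lemma lovasz_add {n : ℕ} (Shat : Finset (Fin n) → ℝ) (hempty : Shat ∅ = 0)
    (f : Fin n → ℝ) (i : Fin n) (t : ℝ) (ht : ∀ j, f i < f j → f i < f j + t) :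
    lovasz Shat (f + t • indic (Finset.univ.filter fun j => f i < f j)) =
      lovasz Shat f + t * Shat (Finset.univ.filter fun j => f i < f j) := by
  have hs : Tuple.sort (f + t • indic (Finset.univ.filter fun j => f i < f j)) =
      Tuple.sort f := by
    apply sort_congr
    intro j k
    have hj := ht j
    have hk := ht k
    by_cases h1 : f i < f j <;> by_cases h2 : f i < f k <;> simp [indic, h1, h2]
    · have := hj h1
      constructor <;> intro <;> linarith
    · have := hk h2
      constructor <;> intro <;> linarith
  have key := tele Shat hempty (Tuple.sort f) (Finset.univ.filter fun j => f i < f j) (by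
    intro k l hkl
    have := Tuple.monotone_sort f hkl
    simp only [Function.comp] at this
    simp only [Finset.mem_filter, Finset.mem_univ, true_and]
    intro h
    linarith)
  unfold lovasz
  rw [hs, ← key, Finset.mul_sum, ← Finset.sum_add_distrib]
  refine Finset.sum_congr rfl fun k _ => ?_
  simp only [Pi.add_apply, Pi.smul_apply, smul_eq_mul]
  ring

/-- for the Lovasz extension `S` of a submodular set function `Ŝ` with
`Ŝ(∅) = Ŝ(V) = 0`, every subgradient `s ∈ ∂S(f)` satisfies
`⟨s, 1_{C_i}⟩ = S(1_{C_i}) = Ŝ(C_i)` for all upper level sets `C_i = {j : f_j > f_i}`. -/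
theorem lovasz_subgradient_on_level_sets {n : ℕ} (Shat : Finset (Fin n) → ℝ)
    (hsubmod : ∀ A B : Finset (Fin n), Shat (A ∪ B) + Shat (A ∩ B) ≤ Shat A + Shat B)
    (hempty : Shat ∅ = 0) (huniv : Shat Finset.univ = 0)
    (f : Fin n → ℝ) (s : Fin n → ℝ) (hs : s ∈ subdiff (lovasz Shat) f) (i : Fin n) :
    ip s (indic (Finset.univ.filter fun j => f i < f j)) =
        lovasz Shat (indic (Finset.univ.filter fun j => f i < f j)) ∧
      lovasz Shat (indic (Finset.univ.filter fun j => f i < f j)) =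
        Shat (Finset.univ.filter fun j => f i < f j) := by
  have h2 : lovasz Shat (indic (Finset.univ.filter fun j => f i < f j)) =
        Shat (Finset.univ.filter fun j => f i < f j) := by
    set C := Finset.univ.filter fun j => f i < f j with hCdef
    refine tele Shat hempty (Tuple.sort (indic C)) C ?_
    intro k l hkl h
    have := Tuple.monotone_sort (indic C) hkl
    simp only [Function.comp] at this
    by_contra h'
    simp only [indic, if_pos h, if_neg h'] at this
    norm_num at this
  refine ⟨?_, h2⟩
  rw [h2]
  obtain ⟨ε, hε, hlt⟩ : ∃ ε : ℝ, 0 < ε ∧ ∀ j, f i < f j → f i < f j + -ε := by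
    rcases (Finset.univ.filter fun j => f i < f j).eq_empty_or_nonempty with h | h
    · refine ⟨1, one_pos, fun j hj => ?_⟩
      have : j ∈ (Finset.univ.filter fun j => f i < f j) := by simp [hj]
      simp [h] at this
    · obtain ⟨a, ha, hmin⟩ := Finset.exists_min_image _ f h
      simp only [Finset.mem_filter, Finset.mem_univ, true_and] at ha hmin
      refine ⟨(f a - f i) / 2, by linarith, fun j hj => ?_⟩
      have := hmin j hj
      linarith
  have hip : ∀ t : ℝ, ip s ((f + t • indic (Finset.univ.filter fun j => f i < f j)) - f) =
      t * ip s (indic (Finset.univ.filter fun j => f i < f j)) := by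
    intro t
    unfold ip
    rw [Finset.mul_sum]
    refine Finset.sum_congr rfl fun k _ => ?_
    simp only [Pi.add_apply, Pi.sub_apply, Pi.smul_apply, smul_eq_mul]
    ring
  have a1 := hs (f + ε • indic (Finset.univ.filter fun j => f i < f j))
  have a2 := hs (f + (-ε) • indic (Finset.univ.filter fun j => f i < f j))
  rw [hip, lovasz_add Shat hempty f i _ (fun j hj => by linarith)] at a1
  rw [hip, lovasz_add Shat hempty f i _ hlt] at a2
  apply le_antisymm
  · exact le_of_mul_le_mul_left (by linarith) hε
  · exact le_of_mul_le_mul_left (by linarith) hε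
end

section
/- Let Ŝ₁, Ŝ₂ : 2^V → ℝ be submodular set functions with Ŝ₁(∅) = Ŝ₁(V) = Ŝ₂(∅) = Ŝ₂(V) = 0, set Ŝ := Ŝ₁ − Ŝ₂, and let S₁, S₂ be the Lovasz extensions of Ŝ₁, Ŝ₂ (so S := S₁ − S₂ is the Lovasz extension of Ŝ). Then for every f ∈ ℝ^V, every s₁ ∈ ∂S₁(f), every s₂ ∈ ∂S₂(f), and every i ∈ V, ⟨s₁ − s₂, 1_{C_i}⟩ = S(1_{C_i}) = Ŝ(C_i), where C_i := {j ∈ V : f_j > f_i}. -/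
open Finset Filter

theorem telescope_indic {n : ℕ} (Shat : Finset (Fin n) → ℝ) (h0 : Shat ∅ = 0)
    (C : Finset (Fin n)) (σ : Equiv.Perm (Fin n)) (hm : Monotone (indic C ∘ σ)) :
    ∑ k : Fin n, indic C (σ k) *
      (Shat (Finset.univ.filter fun j => (k : ℕ) ≤ (σ.symm j : ℕ)) -
       Shat (Finset.univ.filter fun j => (k : ℕ) + 1 ≤ (σ.symm j : ℕ))) = Shat C := by
  set D : ℕ → Finset (Fin n) := fun k => Finset.univ.filter fun j => k ≤ (σ.symm j : ℕ) with hD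
  have key : ∀ k : Fin n, indic C (σ k) * (Shat (D k) - Shat (D (k + 1))) =
      Shat (D k ∩ C) - Shat (D (k + 1) ∩ C) := by
    intro k
    by_cases hk : σ k ∈ C
    · have hsub : D k ⊆ C := by
        intro j hj
        have hj' : k ≤ σ.symm j := by simpa [hD] using hj
        have h := hm hj'
        by_contra hc
        simp [indic, hk, hc] at h
        linarith
      have hsub' : D (k + 1) ⊆ C := by
        refine Finset.Subset.trans ?_ hsub
        intro j hj
        simp only [hD, Finset.mem_filter, Finset.mem_univ, true_and] at hj ⊢
        omega
      rw [Finset.inter_eq_left.2 hsub, Finset.inter_eq_left.2 hsub']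
      simp [indic, hk]
    · have he : D k ∩ C = D (k + 1) ∩ C := by
        ext j
        simp only [hD, Finset.mem_inter, Finset.mem_filter, Finset.mem_univ, true_and]
        constructor
        · rintro ⟨h1, h2⟩
          refine ⟨?_, h2⟩
          rcases Nat.lt_or_ge (k : ℕ) (σ.symm j : ℕ) with h | h
          · exact h
          · exfalso
            have : σ.symm j = k := Fin.ext (le_antisymm h h1)
            apply hk
            rw [← this]
            simpa using h2
        · rintro ⟨h1, h2⟩
          exact ⟨by omega, h2⟩
      rw [he]
      simp [indic, hk]
  have h1 : ∑ k : Fin n, indic C (σ k) * (Shat (D k) - Shat (D (k + 1))) = Shat C := by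
    rw [Finset.sum_congr rfl fun k _ => key k,
      Fin.sum_univ_eq_sum_range (fun k => Shat (D k ∩ C) - Shat (D (k + 1) ∩ C)) n,
      Finset.sum_range_sub' (fun k => Shat (D k ∩ C))]
    have e0 : D 0 ∩ C = C := by simp [hD]
    have en : D n ∩ C = ∅ := by
      have : D n = ∅ := by
        ext j
        have := (σ.symm j).isLt
        simp [hD]
      simp [this]
    rw [e0, en, h0, sub_zero]
  exact h1

theorem lovasz_indic {n : ℕ} (Shat : Finset (Fin n) → ℝ) (h0 : Shat ∅ = 0)
    (C : Finset (Fin n)) : lovasz Shat (indic C) = Shat C :=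
  telescope_indic Shat h0 C _ (Tuple.monotone_sort _)

theorem lovasz_perturb {n : ℕ} (Shat : Finset (Fin n) → ℝ) (h0 : Shat ∅ = 0)
    (f : Fin n → ℝ) (i : Fin n) (t : ℝ) (ht : ∀ j, f i < f j → f i < f j + t) :
    lovasz Shat (f + t • indic (Finset.univ.filter fun j => f i < f j)) =
      lovasz Shat f + t * Shat (Finset.univ.filter fun j => f i < f j) := by
  set C := Finset.univ.filter fun j => f i < f j with hC
  set u := f + t • indic C with hu
  have hux : ∀ x, u x = if f i < f x then f x + t else f x := by
    intro x
    by_cases h : f i < f x <;> simp [hu, hC, indic, h]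
  have hlt : ∀ x y, f x < f y → u x < u y := by
    intro x y h
    rw [hux, hux]
    have := ht y
    split_ifs with h1 h2 h2
    · linarith
    · linarith
    · linarith [this h2]
    · exact h
  have heq : ∀ x y, f x = f y → u x = u y := by
    intro x y h
    rw [hux, hux, h]
  have hinj : ∀ x y, u x = u y → f x = f y := by
    intro x y h
    rcases lt_trichotomy (f x) (f y) with h1 | h1 | h1
    · linarith [hlt _ _ h1]
    · exact h1
    · linarith [hlt _ _ h1]
  have hmono : Monotone (f ∘ Tuple.sort f) := Tuple.monotone_sort f
  have hsort : Tuple.sort f = Tuple.sort u := by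
    rw [Tuple.eq_sort_iff]
    refine ⟨?_, ?_⟩
    · intro a b hab
      rcases (hmono hab).lt_or_eq with h | h
      · exact (hlt _ _ h).le
      · exact (heq _ _ h).le
    · intro a b hab h
      exact (Tuple.eq_sort_iff.1 (rfl : Tuple.sort f = Tuple.sort f)).2 a b hab (hinj _ _ h)
  have hCm : Monotone (indic C ∘ Tuple.sort f) := by
    intro a b hab
    have h := hmono hab
    simp only [Function.comp] at h
    simp only [Function.comp, indic, hC, Finset.mem_filter, Finset.mem_univ, true_and]
    split_ifs <;> linarith
  have hT := telescope_indic Shat h0 C _ hCm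
  rw [← hT]
  unfold lovasz
  rw [← hsort, Finset.mul_sum, ← Finset.sum_add_distrib]
  refine Finset.sum_congr rfl fun k _ => ?_
  simp only [hu, Pi.add_apply, Pi.smul_apply, smul_eq_mul]
  ring

theorem subgrad_level {n : ℕ} (Shat : Finset (Fin n) → ℝ) (h0 : Shat ∅ = 0)
    (f s : Fin n → ℝ) (hs : s ∈ subdiff (lovasz Shat) f) (i : Fin n) :
    ip s (indic (Finset.univ.filter fun j => f i < f j)) =
      Shat (Finset.univ.filter fun j => f i < f j) := by
  have hip : ∀ (t : ℝ) (g : Fin n → ℝ), ip s (f + t • g - f) = t * ip s g := by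
    intro t g
    simp only [ip, Finset.mul_sum]
    refine Finset.sum_congr rfl fun k _ => ?_
    simp
    ring
  obtain ⟨ε, hε, h⟩ : ∃ ε : ℝ, 0 < ε ∧ ∀ j, f i < f j → f i < f j + -ε := by
    have hev : ∀ᶠ ε in nhdsWithin (0 : ℝ) (Set.Ioi 0), ∀ j, f i < f j → f i < f j + -ε := by
      rw [Filter.eventually_all]
      intro j
      by_cases hj : f i < f j
      · filter_upwards [Ioo_mem_nhdsGT (sub_pos.2 hj)] with ε hε _
        linarith [hε.2]
      · exact Filter.Eventually.of_forall fun _ h => absurd h hj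
    obtain ⟨ε, h1, h2⟩ := (hev.and self_mem_nhdsWithin).exists
    exact ⟨ε, h2, h1⟩
  have a := hs (f + ε • indic (Finset.univ.filter fun j => f i < f j))
  have b := hs (f + (-ε) • indic (Finset.univ.filter fun j => f i < f j))
  rw [hip, lovasz_perturb Shat h0 f i _ (fun j hj => by linarith)] at a
  rw [hip, lovasz_perturb Shat h0 f i _ h] at b
  refine le_antisymm ?_ ?_ <;> refine le_of_mul_le_mul_left ?_ hε <;> linarith

/-- for a difference `Ŝ = Ŝ₁ − Ŝ₂` of submodular set functions vanishing on
`∅` and `V`, with Lovasz extensions `S₁, S₂`, all subgradients `s₁ ∈ ∂S₁(f)`, `s₂ ∈ ∂S₂(f)`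
satisfy `⟨s₁ − s₂, 1_{C_i}⟩ = S(1_{C_i}) = Ŝ(C_i)` on upper level sets `C_i = {j : f_j > f_i}`. -/
theorem lovasz_difference_subgradient_on_level_sets {n : ℕ}
    (Shat1 Shat2 : Finset (Fin n) → ℝ)
    (hsub1 : ∀ A B : Finset (Fin n), Shat1 (A ∪ B) + Shat1 (A ∩ B) ≤ Shat1 A + Shat1 B)
    (hsub2 : ∀ A B : Finset (Fin n), Shat2 (A ∪ B) + Shat2 (A ∩ B) ≤ Shat2 A + Shat2 B)
    (hempty1 : Shat1 ∅ = 0) (huniv1 : Shat1 Finset.univ = 0)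
    (hempty2 : Shat2 ∅ = 0) (huniv2 : Shat2 Finset.univ = 0)
    (f : Fin n → ℝ)
    (s1 : Fin n → ℝ) (hs1 : s1 ∈ subdiff (lovasz Shat1) f)
    (s2 : Fin n → ℝ) (hs2 : s2 ∈ subdiff (lovasz Shat2) f)
    (i : Fin n) :
    ip (s1 - s2) (indic (Finset.univ.filter fun j => f i < f j)) =
        lovasz Shat1 (indic (Finset.univ.filter fun j => f i < f j)) -
          lovasz Shat2 (indic (Finset.univ.filter fun j => f i < f j)) ∧
      lovasz Shat1 (indic (Finset.univ.filter fun j => f i < f j)) -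
          lovasz Shat2 (indic (Finset.univ.filter fun j => f i < f j)) =
        Shat1 (Finset.univ.filter fun j => f i < f j) -
          Shat2 (Finset.univ.filter fun j => f i < f j) := by
  have e : ∀ g : Fin n → ℝ, ip (s1 - s2) g = ip s1 g - ip s2 g := by
    intro g
    simp [ip, sub_mul]
  rw [e, subgrad_level Shat1 hempty1 f s1 hs1 i, subgrad_level Shat2 hempty2 f s2 hs2 i,
    lovasz_indic Shat1 hempty1, lovasz_indic Shat2 hempty2]
  exact ⟨rfl, rfl⟩
end

section
/- Let Ŝ : 2^V → ℝ be a symmetric set function (Ŝ(A) = Ŝ(Ā) for all A ⊆ V) with Ŝ(∅) = 0, and let S_L be its Lovasz extension. Let S : ℝ^V → ℝ be any function that is positively one-homogeneous, even, convex, satisfies S(f + α·1) = S(f) for all f ∈ ℝ^V and α ∈ ℝ, and satisfies S(1_A) = Ŝ(A) for all A ⊆ V. Then S_L(f) ≥ S(f) for all f ∈ ℝ^V. -/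
open Finset Filter

/-- the Lovasz extension `S_L` of a symmetric set function `Ŝ` with
`Ŝ(∅) = 0` dominates every one-homogeneous, even, convex, translation-invariant
extension `S` with `S(1_A) = Ŝ(A)`. -/
theorem lovasz_extension_maximal {n : ℕ} (Shat : Finset (Fin n) → ℝ)
    (hsym : ∀ A : Finset (Fin n), Shat Aᶜ = Shat A) (hempty : Shat ∅ = 0)
    (S : (Fin n → ℝ) → ℝ)
    (hhom : PosOneHom S)
    (heven : ∀ f, S (-f) = S f)
    (hconv : ConvexOn ℝ Set.univ S)
    (htrans : ∀ (f : Fin n → ℝ) (α : ℝ), S (fun i => f i + α) = S f)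
    (hind : ∀ A : Finset (Fin n), S (indic A) = Shat A) :
    ∀ f : Fin n → ℝ, S f ≤ lovasz Shat f := by
  intro f
  have h0 : S 0 = 0 := by
    have := hhom 0 le_rfl 0
    simpa using this
  have hadd : ∀ a b, S (a + b) ≤ S a + S b := by
    intro a b
    have h := hconv.2 (Set.mem_univ a) (Set.mem_univ b)
      (show (0:ℝ) ≤ 1/2 by norm_num) (show (0:ℝ) ≤ 1/2 by norm_num) (by norm_num)
    rw [← smul_add, hhom _ (by norm_num)] at h
    simp only [smul_eq_mul] at h
    linarith
  rcases Nat.eq_zero_or_pos n with hn | hn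
  · subst hn
    have : f = 0 := Subsingleton.elim _ _
    rw [this, h0]
    simp [lovasz]
  set p := Tuple.sort f with hp
  have hmono : Monotone (f ∘ p) := Tuple.monotone_sort f
  let g : ℕ → ℝ := fun k => f (p ⟨min k (n-1), by omega⟩)
  let T : ℕ → Finset (Fin n) := fun k => Finset.univ.filter fun j => k ≤ (p.symm j : ℕ)
  have hg : Monotone g := by
    intro a b hab
    apply hmono
    simp only [Fin.mk_le_mk]
    omega
  have hT0 : Shat (T 0) = 0 := by
    have h1 : T 0 = (∅ : Finset (Fin n))ᶜ := by
      ext j; simp [T]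
    rw [h1, hsym, hempty]
  have hTn : Shat (T n) = 0 := by
    have h1 : T n = ∅ := by
      ext j; simp [T]
    rw [h1, hempty]
  have key : ∀ m : ℕ, S (fun j => g (min (p.symm j : ℕ) m)) ≤
      ∑ k ∈ Finset.range m, g k * (Shat (T k) - Shat (T (k+1))) + g m * Shat (T m) := by
    intro m
    induction m with
    | zero =>
      have h1 := htrans 0 (g 0)
      simp only [Pi.zero_apply, zero_add, h0] at h1
      simp [hT0, h1]
    | succ m ih =>
      have h1 : (fun j => g (min (p.symm j : ℕ) (m+1))) =
          (fun j => g (min (p.symm j : ℕ) m)) + (g (m+1) - g m) • indic (T (m+1)) := by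
        funext j
        simp only [Pi.add_apply, Pi.smul_apply, smul_eq_mul, indic, T, Finset.mem_filter,
          Finset.mem_univ, true_and]
        split_ifs with h
        · rw [min_eq_right h, min_eq_right (by omega)]; ring
        · rw [min_eq_left (by omega), min_eq_left (by omega)]; ring
      have h2 := hadd (fun j => g (min (p.symm j : ℕ) m)) ((g (m+1) - g m) • indic (T (m+1)))
      rw [← h1, hhom _ (sub_nonneg.2 (hg (Nat.le_succ m))), hind] at h2
      rw [Finset.sum_range_succ]
      linarith
  have h := key n
  have hf : (fun j => g (min (p.symm j : ℕ) n)) = f := by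
    funext j
    have h1 : (⟨min (min (p.symm j : ℕ) n) (n-1), by omega⟩ : Fin n) = p.symm j := by
      apply Fin.ext
      have := (p.symm j).2
      simp only
      omega
    change f (p _) = f j
    rw [h1, Equiv.apply_symm_apply]
  rw [hf, hTn, mul_zero, add_zero, Finset.sum_range] at h
  refine h.trans (le_of_eq ?_)
  unfold lovasz
  refine Finset.sum_congr rfl fun k _ => ?_
  have h1 : (⟨min (k : ℕ) (n-1), by omega⟩ : Fin n) = k := by
    apply Fin.ext
    have := k.2
    simp only
    omega
  have h2 : g k = f (p k) := by
    change f (p _) = f (p k)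
    rw [h1]
  rw [h2]
end
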